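/- arXiv:1511.07689 — 3 statements merged into one kernel-verified Lean document; each statement's English description precedes it below -/
import Mathlib

section
/- Let A, B be real numbers with A ≠ 0 and D = A² + 4B < 0, and suppose that π⁻¹·arctan(√(−D)/A) is irrational. Let (G_n) be a real sequence, not identically zero, satisfying G_{n+2} = A·G_{n+1} + B·G_n for all n ≥ 0, and assume G_n ≠ 0 for all n. Then the sequence of fractional parts of G_{n+1}/G_n is everywhere dense in [0, 1], but the sequence (G_{n+1}/G_n) is not uniformly distributed modulo 1, i.e. it is not the case that for all 0 ≤ a < b ≤ 1 one has lim_{N→∞} (1/N)·#{n < N : the fractional part of G_{n+1}/G_n lies in [a, b)} = b − a. -/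
open Real Filter

lemma norm_exp_sub_exp_le_of_re_nonpos {a b : ℂ} (ha : a.re ≤ 0) (hb : b.re ≤ 0) :
    ‖Complex.exp a - Complex.exp b‖ ≤ ‖a - b‖ := by
  have h := (convex_halfSpace_re_le 0).norm_image_sub_le_of_norm_deriv_le (𝕜 := ℂ)
    (f := Complex.exp) (C := 1) (fun x _ => Complex.differentiable_exp x)
    (fun x hx => by
      rw [Complex.deriv_exp, Complex.norm_exp]
      exact Real.exp_le_one_iff.2 hx) hb ha
  simpa using h

lemma tendsto_average_pow {ζ : ℂ} (hζ : ‖ζ‖ = 1) (hne : ζ ≠ 1) :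
    Tendsto (fun N : ℕ => (∑ n ∈ Finset.range N, ζ ^ n) / (N : ℂ)) atTop (nhds 0) := by
  have h0 : Tendsto (fun N : ℕ => 2 / ‖ζ - 1‖ / (N : ℝ)) atTop (nhds 0) :=
    tendsto_const_div_atTop_nhds_zero_nat _
  refine squeeze_zero_norm (fun N => ?_) h0
  rw [geom_sum_eq hne, norm_div, norm_div, Complex.norm_natCast]
  gcongr
  calc ‖ζ ^ N - 1‖ ≤ ‖ζ ^ N‖ + ‖(1 : ℂ)‖ := norm_sub_le _ _
    _ = 2 := by rw [norm_pow, hζ]; norm_num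

/-- Averages of a holomorphic function along an irrational rotation of the unit circle tend to its
value at the centre. -/
lemma tendsto_average_rotation {ζ w : ℂ} (hζ : ‖ζ‖ = 1) (hne : ∀ k : ℕ, k ≠ 0 → ζ ^ k ≠ 1)
    (hw : ‖w‖ = 1) {f : ℂ → ℂ} {R : ℝ} (hR : 1 < R)
    (hf : DifferentiableOn ℂ f (Metric.closedBall 0 R)) :
    Tendsto (fun N : ℕ => (∑ n ∈ Finset.range N, f (w * ζ ^ n)) / (N : ℂ)) atTop
      (nhds (f 0)) := by
  lift R to NNReal using by linarith
  have hp := hf.hasFPowerSeriesOnBall (by exact_mod_cast (zero_lt_one.trans hR))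
  set p := cauchyPowerSeries f 0 R
  have hsumm : Summable fun k => ‖p.coeff k‖ := by
    have h1 : ((1 : NNReal) : ENNReal) < p.radius :=
      lt_of_lt_of_le (by exact_mod_cast hR) hp.r_le
    simpa [FormalMultilinearSeries.norm_apply_eq_norm_coef] using p.summable_norm_mul_pow h1
  have hu : ∀ n, ‖w * ζ ^ n‖ = 1 := fun n => by simp [hw, hζ]
  have hsum : ∀ n, HasSum (fun k => p.coeff k * (w * ζ ^ n) ^ k) (f (w * ζ ^ n)) := fun n => by
    have := hp.hasSum (y := w * ζ ^ n) (by
      rw [Metric.mem_eball, edist_zero_right, ← ofReal_norm, hu]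
      simpa using hR)
    simpa [FormalMultilinearSeries.apply_eq_pow_smul_coeff, mul_comm] using this
  have h0 : p.coeff 0 = f 0 := by
    exact hp.coeff_zero _
  have havg : ∀ N : ℕ, (∑ n ∈ Finset.range N, f (w * ζ ^ n)) / (N : ℂ) =
      ∑' k, p.coeff k * (w ^ k * ((∑ n ∈ Finset.range N, (ζ ^ k) ^ n) / (N : ℂ))) := fun N => by
    rw [← ((hasSum_sum fun n _ => hsum n).div_const (N : ℂ)).tsum_eq]
    refine tsum_congr fun k => ?_
    rw [Finset.sum_div, Finset.sum_div, Finset.mul_sum, Finset.mul_sum]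
    refine Finset.sum_congr rfl fun n _ => ?_
    rw [mul_pow, ← pow_mul, ← pow_mul, mul_comm n k]
    ring
  simp_rw [havg]
  have hlim : f 0 = ∑' k, p.coeff k * (if k = 0 then 1 else 0) := by
    simp [h0]
  rw [hlim]
  refine tendsto_tsum_of_dominated_convergence hsumm (fun k => ?_)
    (Eventually.of_forall fun N k => ?_)
  · refine Tendsto.const_mul _ ?_
    split_ifs with hk
    · subst hk
      refine tendsto_const_nhds.congr' ?_
      filter_upwards [eventually_ne_atTop 0] with N hN
      have : (N : ℂ) ≠ 0 := by exact_mod_cast hN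
      simp [this]
    · simpa using (tendsto_average_pow (by simp [hζ]) (hne k hk)).const_mul (w ^ k)
  · rw [norm_mul]
    refine mul_le_of_le_one_right (norm_nonneg _) ?_
    rw [norm_mul, norm_pow, hw, one_pow, one_mul, norm_div, Complex.norm_natCast]
    refine div_le_one_of_le₀ ((norm_sum_le _ _).trans ?_) (Nat.cast_nonneg N)
    simp [hζ]

/-- Exponential averages of a sequence that is uniformly distributed modulo 1 tend to `0`. -/
lemma tendsto_average_exp_of_uniform {x : ℕ → ℝ}
    (h : ∀ a b : ℝ, 0 ≤ a → a < b → b ≤ 1 →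
        Tendsto (fun N : ℕ =>
            (Nat.card {n : ℕ | n < N ∧ Int.fract (x n) ∈ Set.Ico a b} : ℝ) / N)
          atTop (nhds (b - a))) :
    Tendsto (fun N : ℕ => (∑ n ∈ Finset.range N, Complex.exp (2 * π * Complex.I * x n)) / (N : ℂ))
      atTop (nhds 0) := by
  have key : ∀ M : ℕ, 2 ≤ M → ∀ᶠ N : ℕ in atTop,
      ‖(∑ n ∈ Finset.range N, Complex.exp (2 * π * Complex.I * x n)) / (N : ℂ)‖ ≤
        (2 * π + 1) / M := by
    intro M hM
    have hM0 : (0 : ℝ) < M := by positivity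
    set c : ℕ → ℂ := fun j => Complex.exp (2 * π * Complex.I * ((j / M : ℝ) : ℂ)) with hc
    set k : ℕ → ℕ := fun n => ⌊(M : ℝ) * Int.fract (x n)⌋₊ with hk
    have hkM : ∀ n, k n < M := fun n => by
      rw [hk, Nat.floor_lt (by have := Int.fract_nonneg (x n); positivity)]
      nlinarith [Int.fract_lt_one (x n)]
    have hdiff : ∀ n, ‖Complex.exp (2 * π * Complex.I * x n) - c (k n)‖ ≤ 2 * π / M := fun n => by
      have hx : Complex.exp (2 * π * Complex.I * x n) =
          Complex.exp (2 * π * Complex.I * (Int.fract (x n) : ℝ)) := by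
        rw [Complex.exp_eq_exp_iff_exists_int]
        refine ⟨⌊x n⌋, ?_⟩
        have := Int.floor_add_fract (x n)
        have h2 : (x n : ℂ) = (⌊x n⌋ : ℂ) + ((Int.fract (x n) : ℝ) : ℂ) := by
          exact_mod_cast this.symm
        rw [h2]; ring
      rw [hx, hc]
      refine (norm_exp_sub_exp_le_of_re_nonpos (by simp) (by simp)).trans ?_
      rw [← mul_sub, ← Complex.ofReal_sub, norm_mul, Complex.norm_real]
      have h1 := Nat.floor_le (mul_nonneg hM0.le (Int.fract_nonneg (x n)))
      have h2 := Nat.lt_floor_add_one ((M : ℝ) * Int.fract (x n))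
      have h3 : ‖Int.fract (x n) - (k n : ℝ) / M‖ ≤ 1 / M := by
        rw [Real.norm_eq_abs, abs_le]
        constructor
        · have : (k n : ℝ) / M ≤ Int.fract (x n) := by rw [div_le_iff₀ hM0]; linarith
          have : 0 < 1 / (M : ℝ) := by positivity
          linarith
        · rw [sub_le_iff_le_add, ← add_div, le_div_iff₀ hM0]; linarith
      have h4 : ‖(2 * π * Complex.I : ℂ)‖ = 2 * π := by simp [abs_of_pos Real.pi_pos]
      rw [h4]
      calc _ ≤ 2 * π * (1 / M) := by gcongr
        _ = _ := by ring
    have hcount : ∀ N : ℕ, ∑ n ∈ Finset.range N, c (k n) = ∑ j ∈ Finset.range M, c j *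
        ((Nat.card {n : ℕ | n < N ∧ Int.fract (x n) ∈ Set.Ico (j / M : ℝ) ((j + 1) / M)} : ℝ) : ℂ) := by
      intro N
      rw [← Finset.sum_fiberwise_of_maps_to (t := Finset.range M) (g := k)
        (fun n _ => Finset.mem_range.2 (hkM n))]
      refine Finset.sum_congr rfl fun j _ => ?_
      have hset : {n : ℕ | n < N ∧ Int.fract (x n) ∈ Set.Ico (j / M : ℝ) ((j + 1) / M)} =
          ↑((Finset.range N).filter fun n => k n = j) := by
        ext n
        simp only [Set.mem_ofPred_eq, Finset.coe_filter, Finset.mem_range, Set.mem_Ico, hk]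
        rw [Nat.floor_eq_iff (mul_nonneg hM0.le (Int.fract_nonneg _)), div_le_iff₀ hM0,
          lt_div_iff₀ hM0, mul_comm]
      rw [hset, Finset.sum_congr rfl (g := fun _ => c j)
        (fun n hn => by rw [(Finset.mem_filter.1 hn).2])]
      rw [Nat.card_coe_set_eq, Set.ncard_coe_finset]
      simp [mul_comm]
    have hlim : Tendsto (fun N : ℕ => (∑ n ∈ Finset.range N, c (k n)) / (N : ℂ)) atTop (nhds 0) := by
      have h1 : ∑ j ∈ Finset.range M, c j * (((1 / M : ℝ)) : ℂ) = 0 := by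
        have hprim := Complex.isPrimitiveRoot_exp M (by omega)
        have := hprim.geom_sum_eq_zero (by omega)
        rw [← Finset.sum_mul]
        convert zero_mul _
        rw [← this]
        refine Finset.sum_congr rfl fun j _ => ?_
        rw [← Complex.exp_nat_mul]
        simp only [hc]
        congr 1
        push_cast
        ring
      rw [← h1]
      simp_rw [hcount, Finset.sum_div, mul_div_assoc]
      refine tendsto_finsetSum _ fun j hj => Tendsto.const_mul _ ?_
      have hj' : (j : ℝ) + 1 ≤ M := by exact_mod_cast Finset.mem_range.1 hj
      have := h (j / M) ((j + 1) / M) (by positivity) (by gcongr; linarith)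
        (by rw [div_le_one hM0]; exact hj')
      have h2 := (Complex.continuous_ofReal.tendsto _).comp this
      have h3 : ((j : ℝ) + 1) / M - j / M = 1 / M := by ring
      rw [h3] at h2
      refine h2.congr fun N => ?_
      simp
    have hev := hlim.norm.eventually_le_const (u := 1 / (M : ℝ)) (by simp; positivity)
    filter_upwards [hev, eventually_gt_atTop 0] with N hN hN0
    have hN0' : (0 : ℝ) < N := by exact_mod_cast hN0
    have hd : ‖(∑ n ∈ Finset.range N, Complex.exp (2 * π * Complex.I * x n)) / (N : ℂ) -
        (∑ n ∈ Finset.range N, c (k n)) / (N : ℂ)‖ ≤ 2 * π / M := by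
      rw [← sub_div, ← Finset.sum_sub_distrib, norm_div, Complex.norm_natCast, div_le_iff₀ hN0']
      refine (norm_sum_le_of_le _ fun n _ => hdiff n).trans ?_
      simp [mul_comm]
    calc _ ≤ _ := norm_le_norm_sub_add _ ((∑ n ∈ Finset.range N, c (k n)) / (N : ℂ))
      _ ≤ 2 * π / M + 1 / M := add_le_add hd hN
      _ = _ := by ring
  rw [Metric.tendsto_nhds]
  intro ε hε
  have hM : ∀ᶠ M : ℕ in atTop, (2 * π + 1) / (M : ℝ) < ε :=
    (tendsto_const_div_atTop_nhds_zero_nat _).eventually_lt_const hε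
  obtain ⟨M, hMε, hM2⟩ := (hM.and (eventually_ge_atTop 2)).exists
  filter_upwards [key M hM2] with N hN
  rw [dist_zero_right]
  exact hN.trans_lt hMε

lemma circle_exp_pow_ne_one {α : ℝ} (h : Irrational (α / π)) {k : ℕ} (hk : k ≠ 0) :
    ((Circle.exp (2 * α) : Circle) : ℂ) ^ k ≠ 1 := by
  rw [Circle.coe_exp, ← Complex.exp_nat_mul]
  intro h1
  obtain ⟨m, hm⟩ := Complex.exp_eq_one_iff.1 h1
  have h2 : (k : ℂ) * α = m * π := by
    have hI : (2 * Complex.I) ≠ 0 := by simp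
    apply mul_left_cancel₀ hI
    push_cast at hm
    linear_combination hm
  have h3 : (k : ℝ) * α = m * π := by exact_mod_cast h2
  have hk' : (k : ℝ) ≠ 0 := by exact_mod_cast hk
  refine (irrational_iff_ne_rational _).1 h m k (by exact_mod_cast hk) ?_
  push_cast
  rw [div_eq_div_iff pi_ne_zero hk']
  linarith

lemma denseRange_circle_exp_pow {α : ℝ} (h : Irrational (α / π)) :
    DenseRange fun n : ℕ => Circle.exp (2 * α) ^ n := by
  have : Fact (0 < π) := ⟨pi_pos⟩
  have h1 : DenseRange (fun n : ℕ => n • (α : AddCircle π)) :=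
    denseRange_zsmul_iff_nsmul.1 (AddCircle.denseRange_zsmul_coe_iff.2 h)
  have h2 := (AddCircle.homeomorphCircle pi_ne_zero).surjective.denseRange.comp h1
    (AddCircle.homeomorphCircle pi_ne_zero).continuous
  convert h2 using 2 with n
  simp only [Function.comp, AddCircle.homeomorphCircle_apply, AddCircle.toCircle_nsmul,
    AddCircle.toCircle_apply_mk]
  rw [mul_div_assoc, div_self pi_ne_zero, mul_one]

lemma half_le_re_inv_one_sub {z : ℂ} (hz : ‖z‖ ≤ 1) (hz1 : z ≠ 1) :
    1 / 2 ≤ ((1 - z)⁻¹).re := by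
  have h1 : z.re * z.re + z.im * z.im ≤ 1 := by
    rw [← Complex.normSq_apply, Complex.normSq_eq_norm_sq]
    nlinarith [norm_nonneg z]
  have h2 : 0 < Complex.normSq (1 - z) := Complex.normSq_pos.2 (sub_ne_zero.2 hz1.symm)
  rw [Complex.inv_re, le_div_iff₀ h2, Complex.normSq_apply]
  simp only [Complex.sub_re, Complex.sub_im, Complex.one_re, Complex.one_im]
  nlinarith

/-- The pullback of `z ↦ exp (2πiz)` to the unit disc under the Möbius map onto the upper
half-plane sending `0` to `ω` and `1` to `∞`. -/
noncomputable def discExp (ω z : ℂ) : ℂ :=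
  Complex.exp (2 * π * Complex.I * (starRingEnd ℂ ω + 2 * ω.im * Complex.I * (1 - z)⁻¹))

lemma discExp_exponent_re (ω z : ℂ) :
    (2 * π * Complex.I * (starRingEnd ℂ ω + 2 * ω.im * Complex.I * (1 - z)⁻¹)).re =
      2 * π * ω.im * (1 - 2 * ((1 - z)⁻¹).re) := by
  simp only [Complex.mul_re, Complex.mul_im, Complex.add_re, Complex.add_im, Complex.I_re,
    Complex.I_im, Complex.ofReal_re, Complex.ofReal_im, Complex.conj_re, Complex.conj_im,
    Complex.re_ofNat, Complex.im_ofNat]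
  ring

lemma discExp_exponent_re_nonpos {ω z : ℂ} (hω : 0 < ω.im) (hz : ‖z‖ ≤ 1) (hz1 : z ≠ 1) :
    (2 * π * Complex.I * (starRingEnd ℂ ω + 2 * ω.im * Complex.I * (1 - z)⁻¹)).re ≤ 0 := by
  rw [discExp_exponent_re]
  have := half_le_re_inv_one_sub hz hz1
  exact mul_nonpos_of_nonneg_of_nonpos (by positivity) (by linarith)

lemma norm_discExp_le_one {ω z : ℂ} (hω : 0 < ω.im) (hz : ‖z‖ ≤ 1) (hz1 : z ≠ 1) :
    ‖discExp ω z‖ ≤ 1 := by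
  rw [discExp, Complex.norm_exp, Real.exp_le_one_iff]
  exact discExp_exponent_re_nonpos hω hz hz1

lemma discExp_zero (ω : ℂ) : discExp ω 0 = Complex.exp (2 * π * Complex.I * ω) := by
  rw [discExp]
  congr 2
  apply Complex.ext <;> simp
  ring

lemma sub_conj_ne_zero {ω : ℂ} (hω : 0 < ω.im) (x : ℝ) : (x : ℂ) - starRingEnd ℂ ω ≠ 0 := by
  intro h
  have := congrArg Complex.im h
  simp at this
  exact hω.ne' this

lemma one_sub_div_sub_conj {ω : ℂ} (hω : 0 < ω.im) (x : ℝ) :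
    1 - ((x : ℂ) - ω) / (x - starRingEnd ℂ ω) =
      2 * ω.im * Complex.I / (x - starRingEnd ℂ ω) := by
  have h := sub_conj_ne_zero hω x
  have h2 : ω - starRingEnd ℂ ω = 2 * ω.im * Complex.I := by
    rw [Complex.sub_conj]
    push_cast
    ring
  rw [← h2]
  field_simp
  ring

lemma div_sub_conj_ne_one {ω : ℂ} (hω : 0 < ω.im) (x : ℝ) :
    ((x : ℂ) - ω) / (x - starRingEnd ℂ ω) ≠ 1 := by
  intro h
  have h1 := one_sub_div_sub_conj hω x
  rw [h, sub_self] at h1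
  have : (ω.im : ℂ) ≠ 0 := by exact_mod_cast hω.ne'
  exact (div_ne_zero (by simp [this]) (sub_conj_ne_zero hω x)) h1.symm

lemma norm_div_sub_conj {ω : ℂ} (hω : 0 < ω.im) (x : ℝ) :
    ‖((x : ℂ) - ω) / (x - starRingEnd ℂ ω)‖ = 1 := by
  have h : (x : ℂ) - starRingEnd ℂ ω = starRingEnd ℂ (x - ω) := by simp
  have h0 := sub_conj_ne_zero hω x
  rw [h] at h0 ⊢
  have h1 := norm_ne_zero_iff.2 h0
  rw [Complex.norm_conj] at h1
  rw [norm_div, Complex.norm_conj, div_self h1]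

lemma eq_of_disc_coordinate {ω : ℂ} (hω : 0 < ω.im) (x : ℝ) :
    starRingEnd ℂ ω + 2 * ω.im * Complex.I * (1 - ((x : ℂ) - ω) / (x - starRingEnd ℂ ω))⁻¹ = x := by
  have : (ω.im : ℂ) ≠ 0 := by exact_mod_cast hω.ne'
  have h := sub_conj_ne_zero hω x
  rw [one_sub_div_sub_conj hω, inv_div]
  field_simp
  ring

lemma discExp_coordinate {ω : ℂ} (hω : 0 < ω.im) (x : ℝ) :
    discExp ω (((x : ℂ) - ω) / (x - starRingEnd ℂ ω)) = Complex.exp (2 * π * Complex.I * x) := by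
  rw [discExp, eq_of_disc_coordinate hω]

lemma norm_discExp_sub_le {ω : ℂ} (hω : 0 < ω.im) {δ : ℝ} (hδ : 0 < δ) (hδ1 : δ < 1) {z : ℂ}
    (hz : ‖z‖ = 1) (hz1 : z ≠ 1) :
    ‖discExp ω z - discExp ω (((1 - δ ^ 2 : ℝ) : ℂ) * z)‖ ≤
      (8 + 32 * π * ω.im) * ((δ : ℂ) * (((1 + δ : ℝ) : ℂ) - z)⁻¹).re := by
  set r : ℝ := 1 - δ ^ 2 with hr
  set t : ℝ := ‖1 - z‖ with ht
  have hr0 : 0 < r := by nlinarith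
  have hr1 : r < 1 := by nlinarith [sq_pos_of_pos hδ]
  have hrz : ‖(r : ℂ) * z‖ = r := by
    rw [norm_mul, hz, mul_one, Complex.norm_real, Real.norm_of_nonneg hr0.le]
  have hrz1 : (r : ℂ) * z ≠ 1 := fun h => by
    rw [h, norm_one] at hrz
    exact hr1.ne hrz.symm
  have ht0 : 0 < t := norm_pos_iff.2 (sub_ne_zero.2 hz1.symm)
  have hnz : z.re * z.re + z.im * z.im = 1 := by
    rw [← Complex.normSq_apply, Complex.normSq_eq_norm_sq, hz, one_pow]
  have ht2 : t ^ 2 = 2 * (1 - z.re) := by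
    rw [ht, ← Complex.normSq_eq_norm_sq, Complex.normSq_apply]
    simp only [Complex.sub_re, Complex.sub_im, Complex.one_re, Complex.one_im]
    linarith
  have hre : δ ^ 2 / (δ + t) ^ 2 ≤ ((δ : ℂ) * (((1 + δ : ℝ) : ℂ) - z)⁻¹).re := by
    rw [Complex.re_ofReal_mul, Complex.inv_re, Complex.normSq_apply]
    simp only [Complex.sub_re, Complex.sub_im, Complex.ofReal_re, Complex.ofReal_im]
    have hd : 0 < (1 + δ - z.re) * (1 + δ - z.re) + (0 - z.im) * (0 - z.im) := by
      nlinarith [sq_nonneg t, sq_nonneg (0 - z.im)]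
    rw [← mul_div_assoc]
    rw [div_le_div_iff₀ (by positivity) hd]
    have e1 : (1 + δ - z.re) * (1 + δ - z.re) + (0 - z.im) * (0 - z.im) =
        δ ^ 2 + δ * t ^ 2 + t ^ 2 := by rw [ht2]; linarith
    have e2 : 1 + δ - z.re = δ + t ^ 2 / 2 := by linarith
    rw [e1, e2]
    have ht4 : t ≤ 2 := by
      have := norm_sub_le (1 : ℂ) z
      rw [hz, norm_one] at this
      linarith
    have e3 : δ * (δ + t ^ 2 / 2) * (δ + t) ^ 2 - δ ^ 2 * (δ ^ 2 + δ * t ^ 2 + t ^ 2) =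
      δ ^ 2 * (2 * δ * t) + δ * t ^ 2 / 2 * (δ + t) ^ 2 - δ ^ 2 * (δ * t ^ 2) := by ring
    have e4 : δ ^ 2 * (δ * t ^ 2) ≤ δ ^ 2 * (2 * δ * t) := by
      have : t ^ 2 ≤ 2 * t := by nlinarith
      calc _ = δ ^ 3 * t ^ 2 := by ring
        _ ≤ δ ^ 3 * (2 * t) := by gcongr
        _ = _ := by ring
    have e5 : 0 ≤ δ * t ^ 2 / 2 * (δ + t) ^ 2 := by positivity
    linarith
  have hb1 : ‖discExp ω z - discExp ω ((r : ℂ) * z)‖ ≤ 2 := by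
    refine (norm_sub_le _ _).trans ?_
    linarith [norm_discExp_le_one hω hz.le hz1,
      norm_discExp_le_one hω (hrz.le.trans hr1.le) hrz1]
  have hb2 : ‖discExp ω z - discExp ω ((r : ℂ) * z)‖ ≤ 8 * π * ω.im * (δ ^ 2 / t ^ 2) := by
    refine (norm_exp_sub_exp_le_of_re_nonpos (discExp_exponent_re_nonpos hω hz.le hz1)
      (discExp_exponent_re_nonpos hω (hrz.le.trans hr1.le) hrz1)).trans ?_
    have h1 : (1 - z) ≠ 0 := sub_ne_zero.2 hz1.symm
    have h2 : (1 - (r : ℂ) * z) ≠ 0 := sub_ne_zero.2 hrz1.symm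
    have e : 2 * π * Complex.I * (starRingEnd ℂ ω + 2 * ω.im * Complex.I * (1 - z)⁻¹) -
        2 * π * Complex.I * (starRingEnd ℂ ω + 2 * ω.im * Complex.I * (1 - (r : ℂ) * z)⁻¹) =
        ((-(4 * π * ω.im * δ ^ 2) : ℝ) : ℂ) * (z / ((1 - z) * (1 - (r : ℂ) * z))) := by
      have hδr : ((δ : ℂ)) ^ 2 = 1 - r := by rw [hr]; push_cast; ring
      have hinv : (1 - z)⁻¹ - (1 - (r : ℂ) * z)⁻¹ =
          (1 - r) * (z / ((1 - z) * (1 - (r : ℂ) * z))) := by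
        rw [inv_sub_inv h1 h2]
        ring
      push_cast
      rw [hδr]
      linear_combination 4 * π * Complex.I ^ 2 * ω.im * hinv +
        4 * π * ω.im * (1 - r) * (z / ((1 - z) * (1 - (r : ℂ) * z))) * Complex.I_sq
    rw [e, norm_mul, norm_div, norm_mul, hz, Complex.norm_real, norm_neg,
      Real.norm_of_nonneg (by positivity), ← ht]
    have h3 : t / 2 ≤ ‖1 - (r : ℂ) * z‖ := by
      have a1 : t ≤ ‖1 - (r : ℂ) * z‖ + (1 - r) := by
        have : 1 - z = (1 - (r : ℂ) * z) - ((1 - r : ℝ) : ℂ) * z := by push_cast; ring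
        rw [ht, this]
        refine (norm_sub_le _ _).trans ?_
        rw [norm_mul, hz, Complex.norm_real, Real.norm_of_nonneg (by linarith), mul_one]
      have a2 : 1 - r ≤ ‖1 - (r : ℂ) * z‖ := by
        have := norm_sub_norm_le (1 : ℂ) ((r : ℂ) * z)
        rwa [norm_one, hrz] at this
      linarith
    calc 4 * π * ω.im * δ ^ 2 * (1 / (t * ‖1 - (r : ℂ) * z‖))
        ≤ 4 * π * ω.im * δ ^ 2 * (1 / (t * (t / 2))) := by gcongr
      _ = _ := by field_simp; ring
  rcases le_total t δ with hle | hle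
  · have h4 : 1 / 4 ≤ δ ^ 2 / (δ + t) ^ 2 := by
      rw [div_le_div_iff₀ (by norm_num) (by positivity)]
      nlinarith
    have h5 : 0 ≤ 32 * π * ω.im := by positivity
    nlinarith
  · have h4 : 1 / 4 * (δ ^ 2 / t ^ 2) ≤ δ ^ 2 / (δ + t) ^ 2 := by
      rw [div_mul_div_comm, div_le_div_iff₀ (by positivity) (by positivity)]
      have : (δ + t) ^ 2 ≤ 4 * t ^ 2 := by nlinarith
      nlinarith [sq_nonneg δ]
    have h5 : 0 ≤ 32 * π * ω.im := by positivity
    have h6 : 0 ≤ δ ^ 2 / t ^ 2 := by positivity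
    nlinarith

/-- A sequence whose disc coordinates rotate by an angle of infinite order does not have
vanishing first exponential averages: the averages tend to `exp (2πiω)`, not to `0`. -/
lemma not_tendsto_average_exp {ω ζ w : ℂ} (hω : 0 < ω.im) (hζ : ‖ζ‖ = 1)
    (hne : ∀ k : ℕ, k ≠ 0 → ζ ^ k ≠ 1) (hw : ‖w‖ = 1) {x : ℕ → ℝ}
    (hx : ∀ n, ((x n : ℂ) - ω) / (x n - starRingEnd ℂ ω) = w * ζ ^ n) :
    ¬ Tendsto
      (fun N : ℕ => (∑ n ∈ Finset.range N, Complex.exp (2 * π * Complex.I * x n)) / (N : ℂ))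
      atTop (nhds 0) := by
  intro h
  have hz : ∀ n, ‖w * ζ ^ n‖ = 1 := fun n => by simp [hw, hζ]
  have hz1 : ∀ n, w * ζ ^ n ≠ 1 := fun n => hx n ▸ div_sub_conj_ne_one hω (x n)
  have key : ∀ δ : ℝ, 0 < δ → δ < 1 →
      ‖discExp ω 0‖ ≤ (8 + 32 * π * ω.im) * (δ * (1 + δ)⁻¹) := by
    intro δ hδ hδ1
    have hr0 : 0 < 1 - δ ^ 2 := by nlinarith
    have hr1 : 1 - δ ^ 2 < 1 := by nlinarith [sq_pos_of_pos hδ]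
    have hF : Tendsto (fun N : ℕ => (∑ n ∈ Finset.range N,
        discExp ω (((1 - δ ^ 2 : ℝ) : ℂ) * (w * ζ ^ n))) / (N : ℂ)) atTop
        (nhds (discExp ω 0)) := by
      have hd : DifferentiableOn ℂ (fun z => discExp ω (((1 - δ ^ 2 : ℝ) : ℂ) * z))
          (Metric.closedBall 0 (1 + δ ^ 2)) := by
        have : ∀ z ∈ Metric.closedBall (0 : ℂ) (1 + δ ^ 2), 1 - ((1 - δ ^ 2 : ℝ) : ℂ) * z ≠ 0 := by
          intro z hz h0
          rw [mem_closedBall_zero_iff] at hz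
          have h1 := congrArg norm (sub_eq_zero.1 h0)
          rw [norm_one, norm_mul, Complex.norm_real, Real.norm_of_nonneg hr0.le] at h1
          nlinarith [sq_pos_of_pos hδ, sq_pos_of_pos (sq_pos_of_pos hδ)]
        unfold discExp
        refine DifferentiableOn.cexp (DifferentiableOn.const_mul
          (DifferentiableOn.const_add _ (DifferentiableOn.const_mul
            (DifferentiableOn.inv (by fun_prop) this) _)) _)
      simpa using tendsto_average_rotation hζ hne hw (by nlinarith [sq_pos_of_pos hδ]) hd
    have hH : Tendsto (fun N : ℕ => (∑ n ∈ Finset.range N,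
        (δ : ℂ) * (((1 + δ : ℝ) : ℂ) - w * ζ ^ n)⁻¹) / (N : ℂ)) atTop
        (nhds ((δ : ℂ) * (((1 + δ : ℝ) : ℂ) - 0)⁻¹)) := by
      refine tendsto_average_rotation (f := fun z => (δ : ℂ) * (((1 + δ : ℝ) : ℂ) - z)⁻¹)
        hζ hne hw (R := 1 + δ / 2) (by linarith) ?_
      refine DifferentiableOn.const_mul (DifferentiableOn.inv (by fun_prop) ?_) _
      intro z hz h0
      rw [mem_closedBall_zero_iff, ← sub_eq_zero.1 h0, Complex.norm_real,
        Real.norm_of_nonneg (by linarith)] at hz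
      linarith
    have hH' := (Complex.continuous_re.tendsto _).comp hH
    have hlim := (hH'.const_mul (8 + 32 * π * ω.im)).add h.norm
    have e : (8 + 32 * π * ω.im) * ((δ : ℂ) * (((1 + δ : ℝ) : ℂ) - 0)⁻¹).re + ‖(0 : ℂ)‖ =
        (8 + 32 * π * ω.im) * (δ * (1 + δ)⁻¹) := by
      rw [sub_zero, norm_zero, add_zero, ← Complex.ofReal_inv, ← Complex.ofReal_mul,
        Complex.ofReal_re]
    rw [← e]
    refine le_of_tendsto_of_tendsto' hF.norm hlim fun N => ?_
    refine (norm_le_norm_sub_add _ ((∑ n ∈ Finset.range N,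
      Complex.exp (2 * π * Complex.I * x n)) / (N : ℂ))).trans (add_le_add_left ?_ _)
    rw [← sub_div, ← Finset.sum_sub_distrib, norm_div, Complex.norm_natCast, Function.comp,
      Complex.div_natCast_re, Complex.re_sum, ← mul_div_assoc, Finset.mul_sum]
    gcongr
    refine norm_sum_le_of_le _ fun n _ => ?_
    rw [← discExp_coordinate hω, hx, norm_sub_rev]
    exact norm_discExp_sub_le hω hδ hδ1 (hz n) (hz1 n)
  have hpos : 0 < ‖discExp ω 0‖ := norm_pos_iff.2 (Complex.exp_ne_zero _)
  have hc : Tendsto (fun δ : ℝ => (8 + 32 * π * ω.im) * (δ * (1 + δ)⁻¹))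
      (nhdsWithin 0 (Set.Ioi 0)) (nhds 0) := by
    have : ContinuousAt (fun δ : ℝ => (8 + 32 * π * ω.im) * (δ * (1 + δ)⁻¹)) 0 := by
      fun_prop (disch := norm_num)
    simpa using this.tendsto.mono_left nhdsWithin_le_nhds
  have hle := ge_of_tendsto hc (b := ‖discExp ω 0‖) (by
    filter_upwards [Ioo_mem_nhdsGT (zero_lt_one' ℝ)] with δ hδ
    exact key δ hδ.1 hδ.2)
  linarith

lemma denseRange_of_disc_coordinate {ω w : ℂ} {ζ : Circle} (hω : 0 < ω.im)
    (hζ : DenseRange fun n : ℕ => ζ ^ n) (hw : ‖w‖ = 1) {x : ℕ → ℝ}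
    (hx : ∀ n, ((x n : ℂ) - ω) / (x n - starRingEnd ℂ ω) = w * ζ ^ n) :
    DenseRange x := by
  intro y
  set v : ℂ := ((y : ℂ) - ω) / (y - starRingEnd ℂ ω) with hv
  let c : Circle := ⟨w⁻¹ * v, mem_sphere_zero_iff_norm.2 (by
    rw [norm_mul, norm_inv, hw, hv, norm_div_sub_conj hω, inv_one, one_mul])⟩
  have hw0 : w ≠ 0 := by rintro rfl; simp at hw
  let Φ : Circle → ℝ := fun u =>
    (starRingEnd ℂ ω + 2 * ω.im * Complex.I * (1 - w * (u : ℂ))⁻¹).re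
  have hc : w * (c : ℂ) = v := mul_inv_cancel_left₀ hw0 v
  have hΦc : Φ c = y := by
    simp only [Φ, hc, hv, eq_of_disc_coordinate hω, Complex.ofReal_re]
  have hΦx : ∀ n, Φ (ζ ^ n) = x n := fun n => by
    simp only [Φ, Circle.coe_pow, ← hx, eq_of_disc_coordinate hω, Complex.ofReal_re]
  have hcont : ContinuousAt Φ c := by
    have h1 : 1 - w * (c : ℂ) ≠ 0 := by
      rw [hc]
      exact sub_ne_zero.2 (div_sub_conj_ne_one hω y).symm
    have h2 : ContinuousAt (fun u : Circle => (1 - w * (u : ℂ))⁻¹) c :=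
      ContinuousAt.inv₀ (by fun_prop) h1
    exact Complex.continuous_re.continuousAt.comp (by fun_prop)
  rw [← hΦc]
  refine closure_mono ?_ (mem_closure_image hcont (hζ c))
  rintro _ ⟨_, ⟨n, rfl⟩, rfl⟩
  exact ⟨n, (hΦx n).symm⟩

lemma Icc_subset_closure_range_fract {x : ℕ → ℝ} (hx : DenseRange x) :
    Set.Icc (0 : ℝ) 1 ⊆ closure (Set.range fun n => Int.fract (x n)) := by
  rw [← closure_Ioo zero_ne_one]
  refine closure_minimal (fun y hy => ?_) isClosed_closure
  have hmem := mem_closure_iff_nhds.1 (hx y)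
  refine mem_closure_iff_nhds.2 fun t ht => ?_
  obtain ⟨z, ⟨hzt, hz⟩, n, rfl⟩ := hmem _ (inter_mem ht (Ioo_mem_nhds hy.1 hy.2))
  exact ⟨x n, hzt, n, Int.fract_eq_self.2 ⟨hz.1.le, hz.2⟩⟩

lemma conj_div_self_eq_circle_exp {ω : ℂ} (hre : ω.re ≠ 0) :
    starRingEnd ℂ ω / ω = (Circle.exp (2 * -Real.arctan (ω.im / ω.re)) : ℂ) := by
  set α := Real.arctan (ω.im / ω.re) with hα
  have hcos : Real.cos α ≠ 0 := (Real.cos_arctan_pos _).ne'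
  have hsin : Real.sin α * ω.re = Real.cos α * ω.im := by
    have := Real.tan_arctan (ω.im / ω.re)
    rw [← hα, Real.tan_eq_sin_div_cos, div_eq_div_iff hcos hre] at this
    linarith
  have h1 : (Real.cos α : ℂ) * ω = ω.re * Complex.exp (α * Complex.I) := by
    rw [Complex.exp_mul_I, ← Complex.ofReal_cos, ← Complex.ofReal_sin]
    apply Complex.ext <;> simp
    · ring
    · rw [Complex.cos_ofReal_re, Complex.sin_ofReal_re]
      linarith
  have h2 : (Real.cos α : ℂ) * starRingEnd ℂ ω = ω.re * Complex.exp (-(α * Complex.I)) := by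
    have := congrArg (starRingEnd ℂ) h1
    simpa only [map_mul, Complex.conj_ofReal, ← Complex.exp_conj, Complex.conj_I, mul_neg] using this
  have hc : (Real.cos α : ℂ) ≠ 0 := by exact_mod_cast hcos
  have hr : (ω.re : ℂ) ≠ 0 := by exact_mod_cast hre
  rw [← mul_div_mul_left _ _ hc, h1, h2, mul_div_mul_left _ _ hr, ← Complex.exp_sub,
    Circle.coe_exp]
  congr 1
  push_cast
  ring

lemma disc_coordinate_of_recurrence {A B : ℝ} {G : ℕ → ℝ} {ω : ℂ} (hω : 0 < ω.im)
    (hA : A = 2 * ω.re) (hB : B = -Complex.normSq ω)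
    (hrec : ∀ n, G (n + 2) = A * G (n + 1) + B * G n) (hG : ∀ n, G n ≠ 0) (n : ℕ) :
    (((G (n + 1) / G n : ℝ) : ℂ) - ω) / ((G (n + 1) / G n : ℝ) - starRingEnd ℂ ω) =
      (((G 1 / G 0 : ℝ) : ℂ) - ω) / ((G 1 / G 0 : ℝ) - starRingEnd ℂ ω) *
        (starRingEnd ℂ ω / ω) ^ n := by
  induction n with
  | zero => simp
  | succ n ih =>
    rw [pow_succ, ← mul_assoc, ← ih]
    have hω0 : ω ≠ 0 := by rintro rfl; simp at hω
    have hn : (G n : ℂ) ≠ 0 := by exact_mod_cast hG n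
    have hn1 : (G (n + 1) : ℂ) ≠ 0 := by exact_mod_cast hG (n + 1)
    have hA' : (A : ℂ) = ω + starRingEnd ℂ ω := by rw [Complex.add_conj, hA]
    have hB' : (B : ℂ) = -(ω * starRingEnd ℂ ω) := by rw [Complex.mul_conj, hB]; simp
    have h0 := sub_conj_ne_zero hω (G (n + 1) / G n)
    have h1 := sub_conj_ne_zero hω (G (n + 1 + 1) / G (n + 1))
    rw [div_mul_div_comm, div_eq_div_iff h1 (mul_ne_zero h0 hω0)]
    rw [hrec]
    push_cast
    rw [hA', hB']
    field_simp
    ring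

/-- Kiss–Tichy (1986): for a real second order linear recurrence
`G_{n+2} = A·G_{n+1} + B·G_n` with negative discriminant `D = A² + 4B` and
`π⁻¹·arctan(√(-D)/A)` irrational, the fractional parts of `G_{n+1}/G_n` are
everywhere dense in `[0,1]`, but the sequence `(G_{n+1}/G_n)` is not uniformly
distributed modulo 1. -/
theorem kiss_tichy_ratios (A B : ℝ) (hA : A ≠ 0) (hD : A ^ 2 + 4 * B < 0)
    (hirr : Irrational (π⁻¹ * Real.arctan (Real.sqrt (-(A ^ 2 + 4 * B)) / A)))
    (G : ℕ → ℝ) (hG0 : G ≠ 0)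
    (hrec : ∀ n, G (n + 2) = A * G (n + 1) + B * G n)
    (hGn : ∀ n, G n ≠ 0) :
    Set.Icc (0 : ℝ) 1 ⊆ closure (Set.range fun n => Int.fract (G (n + 1) / G n)) ∧
    ¬(∀ a b : ℝ, 0 ≤ a → a < b → b ≤ 1 →
        Tendsto
          (fun N : ℕ =>
            (Nat.card {n : ℕ | n < N ∧ Int.fract (G (n + 1) / G n) ∈ Set.Ico a b} : ℝ) / N)
          atTop (nhds (b - a))) := by
  set s := Real.sqrt (-(A ^ 2 + 4 * B)) with hs
  have hs0 : 0 < s := Real.sqrt_pos.2 (by linarith)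
  have hs2 : s ^ 2 = -(A ^ 2 + 4 * B) := Real.sq_sqrt (by linarith)
  let ω : ℂ := ⟨A / 2, s / 2⟩
  have hω : 0 < ω.im := half_pos hs0
  have hre : ω.re ≠ 0 := div_ne_zero hA two_ne_zero
  have hB : B = -Complex.normSq ω := by
    rw [Complex.normSq_apply]
    change B = -(A / 2 * (A / 2) + s / 2 * (s / 2))
    linarith
  have hcoord := disc_coordinate_of_recurrence hω (mul_div_cancel₀ A two_ne_zero).symm hB hrec hGn
  rw [conj_div_self_eq_circle_exp hre] at hcoord
  have hα : Irrational (-Real.arctan (ω.im / ω.re) / π) := by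
    have e : ω.im / ω.re = s / A := div_div_div_cancel_right₀ two_ne_zero s A
    rw [e, neg_div, div_eq_inv_mul]
    exact hirr.neg
  have hw := norm_div_sub_conj hω (G 1 / G 0)
  refine ⟨Icc_subset_closure_range_fract
    (denseRange_of_disc_coordinate hω (denseRange_circle_exp_pow hα) hw hcoord), fun h => ?_⟩
  exact not_tendsto_average_exp hω (Circle.norm_coe _)
    (fun k hk => circle_exp_pow_ne_one hα hk) hw hcoord (tendsto_average_exp_of_uniform h)
end

section
/- Let K be an algebraic number field of degree 2 over ℚ with ring of integers O_K. Then every element of O_K can be written as a sum of finitely many pairwise distinct units of O_K if and only if K contains a square root of 2 or a square root of 5 (equivalently, K = ℚ(√2) or K = ℚ(√5)). -/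
open NumberField

/-- A finite sum of units can be rewritten without cancelling pairs `u, -u`. -/
lemma exists_sum_units_eq_and_neg_notMem {R : Type*} [CommRing R] [CharZero R] [IsDomain R]
    (s : Finset Rˣ) :
    ∃ t : Finset Rˣ, ∑ u ∈ s, (u : R) = ∑ u ∈ t, (u : R) ∧ ∀ u ∈ t, -u ∉ t := by
  classical
  induction s using Finset.strongInduction with
  | H s ih =>
    by_cases h : ∀ u ∈ s, -u ∉ s
    · exact ⟨s, rfl, h⟩
    · push Not at h
      obtain ⟨u, hu, hnu⟩ := h
      have hne : -u ≠ u := fun h ↦ by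
        have h' : -(u : R) = u := by rw [← Units.val_neg, h]
        exact u.ne_zero (self_eq_neg.mp h'.symm)
      have hmem : -u ∈ s.erase u := Finset.mem_erase.mpr ⟨hne, hnu⟩
      obtain ⟨t, ht, ht'⟩ := ih ((s.erase u).erase (-u))
        ((Finset.erase_ssubset hmem).trans (Finset.erase_ssubset hu))
      refine ⟨t, ?_, ht'⟩
      rw [← ht, ← Finset.add_sum_erase _ _ hu, ← Finset.add_sum_erase _ _ hmem, Units.val_neg,
        add_neg_cancel_left]

/-- A finite family of positive reals, any two of which differ by a factor of at least `q > 1`,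
is dominated by a geometric series. -/
lemma sum_le_of_ratio_le {ι : Type*} (f : ι → ℝ) {q : ℝ} (hq : 1 < q) (s : Finset ι) :
    ∀ M : ℝ, 0 ≤ M → (∀ i ∈ s, 0 < f i ∧ f i ≤ M) →
      (∀ i ∈ s, ∀ j ∈ s, i ≠ j → q * f i ≤ f j ∨ q * f j ≤ f i) →
      ∑ i ∈ s, f i ≤ M * (q / (q - 1)) := by
  classical
  have hq' : 0 < q - 1 := by linarith
  induction s using Finset.induction_on_max_value f with
  | empty => intro M hM _ _; simp only [Finset.sum_empty]; positivity
  | insert a s ha hmax ih =>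
    intro M hM hf hs
    have hfa := hf a (Finset.mem_insert_self a s)
    have hle : ∑ i ∈ s, f i ≤ f a / q * (q / (q - 1)) := by
      refine ih _ (div_nonneg hfa.1.le (by linarith)) (fun i hi ↦ ?_) fun i hi j hj ↦
        hs i (Finset.mem_insert_of_mem hi) j (Finset.mem_insert_of_mem hj)
      have hi' := hf i (Finset.mem_insert_of_mem hi)
      refine ⟨hi'.1, (le_div_iff₀' (by linarith)).mpr ?_⟩
      rcases hs i (Finset.mem_insert_of_mem hi) a (Finset.mem_insert_self a s)
        (fun h ↦ ha (h ▸ hi)) with h | h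
      · exact h
      · nlinarith [hmax i hi]
    rw [Finset.sum_insert ha]
    calc f a + ∑ i ∈ s, f i ≤ f a + f a / q * (q / (q - 1)) := by gcongr
      _ = f a * (q / (q - 1)) := by field_simp; ring
      _ ≤ M * (q / (q - 1)) := by gcongr; exact hfa.2

/-- If the absolute values of units differ by factors of at least `q` and miss the interval
`(M, M')`, then the absolute values of sums of distinct units miss an interval too. -/
lemma ne_sum_units_of_gap {R : Type*} [CommRing R] [CharZero R] [IsDomain R] (σ : R →+* ℝ)
    (hσ : Function.Injective σ) {q M M' : ℝ} (hq : 2 < q) (hM : 0 ≤ M)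
    (hratio : ∀ u : Rˣ, 1 < |σ u| → q ≤ |σ u|)
    (hgap : ∀ u : Rˣ, |σ u| ≤ M ∨ M' ≤ |σ u|) {α : R}
    (hα : M * (q / (q - 1)) < |σ α|) (hα' : |σ α| < M' * ((q - 2) / (q - 1))) (s : Finset Rˣ) :
    α ≠ ∑ u ∈ s, (u : R) := by
  classical
  intro hs
  have hq' : 0 < q - 1 := by linarith
  obtain ⟨t, hst, ht⟩ := exists_sum_units_eq_and_neg_notMem s
  rw [hst] at hs
  have hpos (u : Rˣ) : 0 < |σ u| :=
    abs_pos.mpr fun h ↦ u.ne_zero (hσ (by rw [h, map_zero]))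
  have hlt (u v : Rˣ) (h : |σ u| < |σ v|) : q * |σ u| ≤ |σ v| := by
    have hv : |σ v| = |σ (v * u⁻¹ : Rˣ)| * |σ u| := by
      rw [← abs_mul, ← map_mul, ← Units.val_mul, inv_mul_cancel_right]
    have h1 : 1 < |σ (v * u⁻¹ : Rˣ)| := by
      by_contra! hle
      nlinarith [hpos u]
    rw [hv]
    exact mul_le_mul_of_nonneg_right (hratio _ h1) (hpos u).le
  have hsep : ∀ u ∈ t, ∀ v ∈ t, u ≠ v → q * |σ u| ≤ |σ v| ∨ q * |σ v| ≤ |σ u| := by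
    intro u hu v hv huv
    rcases lt_trichotomy |σ u| |σ v| with h | h | h
    · exact .inl (hlt u v h)
    · rcases abs_eq_abs.mp h with h | h
      · exact absurd (Units.ext (hσ h)) huv
      · rw [← map_neg, ← Units.val_neg] at h
        exact absurd (Units.ext (hσ h) ▸ hu) (ht v hv)
    · exact .inr (hlt v u h)
  by_cases hall : ∀ u ∈ t, |σ u| ≤ M
  · refine hα.not_ge ?_
    rw [hs, map_sum]
    exact (Finset.abs_sum_le_sum_abs _ _).trans
      (sum_le_of_ratio_le _ (by linarith) t M hM (fun u hu ↦ ⟨hpos u, hall u hu⟩) hsep)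
  · push Not at hall
    obtain ⟨v, hv, hMv⟩ := hall
    obtain ⟨w, hw, hwmax⟩ := t.exists_max_image (fun u : Rˣ ↦ |σ u|) ⟨v, hv⟩
    have hM' : M' ≤ |σ w| := (hgap w).resolve_left (hMv.trans_le (hwmax v hv)).not_ge
    have hrest : |∑ u ∈ t.erase w, σ u| ≤ |σ w| / q * (q / (q - 1)) := by
      refine (Finset.abs_sum_le_sum_abs _ _).trans (sum_le_of_ratio_le _ (by linarith) _ _
        (div_nonneg (abs_nonneg _) (by linarith)) (fun u hu ↦ ⟨hpos u, ?_⟩)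
        fun u hu x hx ↦ hsep u (Finset.mem_of_mem_erase hu) x (Finset.mem_of_mem_erase hx))
      rw [le_div_iff₀' (by linarith)]
      rcases hsep u (Finset.mem_of_mem_erase hu) w hw (Finset.ne_of_mem_erase hu) with h | h
      · exact h
      · nlinarith [hwmax u (Finset.mem_of_mem_erase hu), hpos w]
    have hle : |σ w| * ((q - 2) / (q - 1)) ≤ |σ α| := by
      rw [hs, map_sum, ← Finset.add_sum_erase _ _ hw]
      have htri := abs_sub_abs_le_abs_sub (σ w) (-∑ u ∈ t.erase w, σ u)
      rw [abs_neg, sub_neg_eq_add] at htri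
      have : |σ w| * ((q - 2) / (q - 1)) = |σ w| - |σ w| / q * (q / (q - 1)) := by
        field_simp; ring
      linarith
    have : M' * ((q - 2) / (q - 1)) ≤ |σ w| * ((q - 2) / (q - 1)) :=
      mul_le_mul_of_nonneg_right hM' (div_nonneg (by linarith) hq'.le)
    linarith

/-- Being a sum of distinct units of absolute value less than `1` can be checked after multiplying
by a unit `ε` and subtracting a digit. -/
lemma exists_small_units_of_mul_sub {R : Type*} [CommRing R] (σ : R →+* ℝ) {ε : Rˣ}
    (hε : 1 < σ ε) {x d : R} (hd : d = 0 ∨ d = 1 ∨ d = -1)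
    (h : ∃ s : Finset Rˣ, (∀ u ∈ s, |σ u| < 1) ∧ ε * x - d = ∑ u ∈ s, (u : R)) :
    ∃ s : Finset Rˣ, (∀ u ∈ s, |σ u| < 1) ∧ x = ∑ u ∈ s, (u : R) := by
  classical
  have hscale (s : Finset Rˣ) (hs : ∀ u ∈ s, |σ u| ≤ 1) (hx : ε * x = ∑ u ∈ s, (u : R)) :
      ∃ s : Finset Rˣ, (∀ u ∈ s, |σ u| < 1) ∧ x = ∑ u ∈ s, (u : R) := by
    refine ⟨s.map (Equiv.mulLeft ε⁻¹).toEmbedding, ?_, ?_⟩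
    · simp only [Finset.mem_map_equiv, Equiv.mulLeft_symm, inv_inv]
      intro u hu
      have h1 : |σ ε| * |σ u| ≤ 1 := by
        simpa [abs_mul] using hs _ hu
      rw [abs_of_pos (by linarith : 0 < σ ε)] at h1
      nlinarith [abs_nonneg (σ u)]
    · simp [Finset.sum_map, ← Finset.mul_sum, ← hx]
  have hunit (s : Finset Rˣ) (hs : ∀ u ∈ s, |σ u| < 1) (v : Rˣ) (hv : |σ v| = 1)
      (hx : ε * x - v = ∑ u ∈ s, (u : R)) :
      ∃ s : Finset Rˣ, (∀ u ∈ s, |σ u| < 1) ∧ x = ∑ u ∈ s, (u : R) := by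
    have hvs : v ∉ s := fun hmem ↦ (hs v hmem).ne hv
    refine hscale (insert v s) ?_ ?_
    · simp only [Finset.mem_insert, forall_eq_or_imp]
      exact ⟨hv.le, fun u hu ↦ (hs u hu).le⟩
    · rw [Finset.sum_insert hvs, ← hx, add_sub_cancel]
  obtain ⟨s, hs, hx⟩ := h
  rcases hd with rfl | rfl | rfl
  · exact hscale s (fun u hu ↦ (hs u hu).le) (by rw [← hx, sub_zero])
  · exact hunit s hs 1 (by simp) (by simpa using hx)
  · exact hunit s hs (-1) (by simp) (by simpa using hx)

lemma exists_eq_sum_units_of_small {R : Type*} [CommRing R] (σ : R →+* ℝ) {ε : Rˣ}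
    (hε : 1 < σ ε)
    (h : ∀ x : R, |σ x| ≤ 1 / 2 →
      ∃ s : Finset Rˣ, (∀ u ∈ s, |σ u| < 1) ∧ x = ∑ u ∈ s, (u : R)) (α : R) :
    ∃ s : Finset Rˣ, α = ∑ u ∈ s, (u : R) := by
  obtain ⟨n, hn⟩ := pow_unbounded_of_one_lt (2 * |σ α|) hε
  have hmul : α = (ε ^ n : Rˣ) * (((ε ^ n)⁻¹ : Rˣ) * α) := (Units.mul_inv_cancel_left _ _).symm
  obtain ⟨s, -, hs⟩ := h (((ε ^ n)⁻¹ : Rˣ) * α) (by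
    have habs := congrArg (fun y ↦ |σ y|) hmul
    have hpos : 0 < σ ε ^ n := pow_pos (by linarith) n
    simp only [map_mul, abs_mul, Units.val_pow_eq_pow_val, map_pow, abs_pow] at habs ⊢
    rw [abs_of_pos (by linarith : 0 < σ ε)] at habs
    by_contra! hlt
    nlinarith)
  refine ⟨s.map (Equiv.mulLeft (ε ^ n)).toEmbedding, ?_⟩
  rw [Finset.sum_map, hmul, hs, Finset.mul_sum]
  simp

lemma exists_digit {y : ℝ} (hy : |y| ≤ 3 / 2) : ∃ d : ℤ, (d = 0 ∨ d = 1 ∨ d = -1) ∧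
    |y - d| ≤ 1 / 2 := by
  rw [abs_le] at hy
  rcases lt_or_ge y (-(1 / 2)) with h | h
  · exact ⟨-1, by simp, by rw [abs_le]; push_cast; constructor <;> linarith⟩
  rcases le_or_gt y (1 / 2) with h' | h'
  · exact ⟨0, by simp, by rw [abs_le]; push_cast; constructor <;> linarith⟩
  · exact ⟨1, by simp, by rw [abs_le]; push_cast; constructor <;> linarith⟩

lemma exists_eq_sum_units_of_sq_eq_two {R : Type*} [CommRing R] (σ : R →+* ℝ) {s : R}
    (hs : s ^ 2 = 2) (hpos : 0 < σ s) (hspan : ∀ x : R, ∃ a b : ℤ, x = a + b * s) (α : R) :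
    ∃ t : Finset Rˣ, α = ∑ u ∈ t, (u : R) := by
  let ε : Rˣ := ⟨1 + s, s - 1, by linear_combination hs, by linear_combination hs⟩
  have hr : σ s ^ 2 = 2 := by rw [← map_pow, hs, map_ofNat]
  set r := σ s
  have hr1 : 1.41 < r := by norm_num; nlinarith
  have hr2 : r < 1.42 := by norm_num; nlinarith
  have hε : σ ε = 1 + r := by simp [ε, r]
  have key (n : ℕ) : ∀ a b : ℤ, b.natAbs ≤ n → |σ (a + b * s)| ≤ 1 / 2 →
      ∃ t : Finset Rˣ, (∀ u ∈ t, |σ u| < 1) ∧ a + b * s = ∑ u ∈ t, (u : R) := by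
    induction n with
    | zero =>
      intro a b hb h
      obtain rfl : b = 0 := by omega
      obtain rfl : a = 0 := by
        have : |(a : ℝ)| < 1 := by
          simp only [Int.cast_zero, zero_mul, add_zero, map_intCast] at h
          linarith
        exact Int.abs_lt_one_iff.mp (by exact_mod_cast this)
      exact ⟨∅, by simp⟩
    | succ n ih =>
      intro a b hb h
      have h' := h
      simp only [map_add, map_mul, map_intCast] at h'
      obtain ⟨d, hd, hyd⟩ := exists_digit (y := σ (ε * (a + b * s))) (by
        rw [map_mul, abs_mul, hε, abs_of_pos (by linarith)]
        nlinarith [abs_nonneg (σ (a + b * s))])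
      have hmul : (ε : R) * (a + b * s) - (d : R) = (a + 2 * b - d : ℤ) + (a + b : ℤ) * s := by
        simp only [ε]
        push_cast
        linear_combination (b : R) * hs
      refine exists_small_units_of_mul_sub σ (ε := ε) (d := d) (by linarith)
        (by rcases hd with rfl | rfl | rfl <;> simp) ?_
      rw [hmul]
      refine ih _ _ ?_ (by rw [← hmul, map_sub, map_intCast]; exact hyd)
      rw [abs_le] at h'
      rcases lt_trichotomy b 0 with hb0 | rfl | hb0
      · have hb1 : (b : ℝ) ≤ -1 := by exact_mod_cast (by omega : b ≤ -1)
        have h1 : (0 : ℝ) < a := by norm_num at hr1; nlinarith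
        have h2 : (a : ℝ) < -2 * b := by norm_num at hr2; nlinarith
        norm_cast at h1 h2
        omega
      · have : |(a : ℝ)| < 1 := by
          rw [abs_lt]; push_cast at h'; constructor <;> linarith
        have : a = 0 := Int.abs_lt_one_iff.mp (by exact_mod_cast this)
        omega
      · have hb1 : (1 : ℝ) ≤ b := by exact_mod_cast hb0
        have h1 : (a : ℝ) < 0 := by norm_num at hr1; nlinarith
        have h2 : -2 * b < (a : ℝ) := by norm_num at hr2; nlinarith
        norm_cast at h1 h2
        omega
  refine exists_eq_sum_units_of_small σ (ε := ε) (by linarith) (fun x hx ↦ ?_) α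
  obtain ⟨a, b, rfl⟩ := hspan x
  exact key _ a b le_rfl hx

lemma exists_eq_sum_units_of_sq_eq_add_one {R : Type*} [CommRing R] (σ : R →+* ℝ) {w : R}
    (hw : w ^ 2 = w + 1) (hpos : 0 < σ w) (hspan : ∀ x : R, ∃ a b : ℤ, x = a + b * w) (α : R) :
    ∃ t : Finset Rˣ, α = ∑ u ∈ t, (u : R) := by
  let ε : Rˣ := ⟨w, w - 1, by linear_combination hw, by linear_combination hw⟩
  have hr : σ w ^ 2 = σ w + 1 := by rw [← map_pow, hw, map_add, map_one]
  set r := σ w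
  have hr1 : 1.61 < r := by norm_num; nlinarith
  have hr2 : r < 1.62 := by norm_num; nlinarith
  have hε : σ ε = r := rfl
  let η : Rˣ := ε⁻¹ ^ 2
  have hη : (η : R) = 2 - w := by
    simp only [η, ε, Units.val_pow_eq_pow_val, Units.inv_mk]
    linear_combination hw
  have hη' : |σ η| < 1 := by
    rw [hη, map_sub, map_ofNat, abs_lt]
    norm_num at hr1 hr2
    constructor <;> linarith
  have key (n : ℕ) : ∀ a b : ℤ, b.natAbs ≤ n → |σ (a + b * w)| ≤ 1 / 2 →
      ∃ t : Finset Rˣ, (∀ u ∈ t, |σ u| < 1) ∧ a + b * w = ∑ u ∈ t, (u : R) := by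
    induction n with
    | zero =>
      intro a b hb h
      obtain rfl : b = 0 := by omega
      obtain rfl : a = 0 := by
        have : |(a : ℝ)| < 1 := by
          simp only [Int.cast_zero, zero_mul, add_zero, map_intCast] at h
          linarith
        exact Int.abs_lt_one_iff.mp (by exact_mod_cast this)
      exact ⟨∅, by simp⟩
    | succ n ih =>
      intro a b hb h
      have h' := h
      simp only [map_add, map_mul, map_intCast] at h'
      rw [abs_le] at h'
      norm_num at hr1 hr2
      by_cases hb1 : b = 1
      · subst hb1
        push_cast at h'
        have h1 : (a : ℝ) < -1 := by linarith
        have h2 : (-3 : ℝ) < a := by linarith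
        norm_cast at h1 h2
        obtain rfl : a = -2 := by omega
        refine ⟨{-η}, by simpa using hη', ?_⟩
        rw [Finset.sum_singleton, Units.val_neg, hη]
        push_cast
        ring
      by_cases hb2 : b = -1
      · subst hb2
        push_cast at h'
        have h1 : (a : ℝ) < 3 := by linarith
        have h2 : (1 : ℝ) < a := by linarith
        norm_cast at h1 h2
        obtain rfl : a = 2 := by omega
        refine ⟨{η}, by simpa using hη', ?_⟩
        rw [Finset.sum_singleton, hη]
        push_cast
        ring
      obtain ⟨d, hd, hyd⟩ := exists_digit (y := σ (ε * (a + b * w))) (by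
        rw [map_mul, abs_mul, hε, abs_of_pos (by linarith)]
        nlinarith [abs_nonneg (σ (a + b * w))])
      have hmul : (ε : R) * (a + b * w) - (d : R) = (b - d : ℤ) + (a + b : ℤ) * w := by
        simp only [ε]
        push_cast
        linear_combination (b : R) * hw
      refine exists_small_units_of_mul_sub σ (ε := ε) (d := d) (by linarith)
        (by rcases hd with rfl | rfl | rfl <;> simp) ?_
      rw [hmul]
      refine ih _ _ ?_ (by rw [← hmul, map_sub, map_intCast]; exact hyd)
      rcases lt_trichotomy b 0 with hb0 | rfl | hb0
      · have hb3 : (b : ℝ) ≤ -2 := by exact_mod_cast (by omega : b ≤ -2)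
        have h1 : (0 : ℝ) < a := by nlinarith
        have h2 : (a : ℝ) < -2 * b := by nlinarith
        norm_cast at h1 h2
        omega
      · have : |(a : ℝ)| < 1 := by
          rw [abs_lt]; push_cast at h'; constructor <;> linarith
        have : a = 0 := Int.abs_lt_one_iff.mp (by exact_mod_cast this)
        omega
      · have hb3 : (2 : ℝ) ≤ b := by exact_mod_cast (by omega : 2 ≤ b)
        have h1 : (a : ℝ) < 0 := by nlinarith
        have h2 : -2 * b < (a : ℝ) := by nlinarith
        norm_cast at h1 h2
        omega
  refine exists_eq_sum_units_of_small σ (ε := ε) (by linarith) (fun x hx ↦ ?_) α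
  obtain ⟨a, b, rfl⟩ := hspan x
  exact key _ a b le_rfl hx

lemma Int.prime_five : Prime (5 : ℤ) := by norm_num

section NumberField

variable {K : Type*} [Field K] [NumberField K]

/-- Cayley–Hamilton for the ring of integers of a quadratic field. -/
lemma sq_sub_mul_add_norm_eq_zero (hdeg : Module.finrank ℚ K = 2) (x : 𝓞 K) :
    ∃ t : ℤ, x ^ 2 - (t : 𝓞 K) * x + (Algebra.norm ℤ x : ℤ) = 0 := by
  have hrank : Module.finrank ℤ (𝓞 K) = 2 := (RingOfIntegers.rank K).trans hdeg
  let b := Module.finBasisOfFinrankEq ℤ (𝓞 K) hrank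
  let A := Algebra.leftMulMatrix b x
  refine ⟨A.trace, Algebra.leftMulMatrix_injective b ?_⟩
  have h := A.aeval_self_charpoly
  rw [Matrix.charpoly_fin_two] at h
  rw [Algebra.norm_eq_matrix_det b]
  simpa [A, Algebra.algebraMap_eq_smul_one, ← zsmul_eq_mul] using h

/-- A unit greater than `1` of a real quadratic field other than `ℚ(√2)`, `ℚ(√5)` is at least
`3.7`, unless it is `(3 + √13) / 2`. -/
lemma le_or_mem_Icc_of_one_lt (hdeg : Module.finrank ℚ K = 2) (h2 : ¬ ∃ s : K, s ^ 2 = 2)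
    (h5 : ¬ ∃ s : K, s ^ 2 = 5) (σ : 𝓞 K →+* ℝ) (u : (𝓞 K)ˣ) (hu : 1 < σ u) :
    3.7 ≤ σ u ∨ σ u ∈ Set.Icc 3.3 3.31 := by
  obtain ⟨t, ht⟩ := sq_sub_mul_add_norm_eq_zero hdeg (u : 𝓞 K)
  have hσ := congrArg σ ht
  have hK := congrArg (algebraMap (𝓞 K) K) ht
  have hN : IsUnit (Algebra.norm ℤ (u : 𝓞 K)) := u.isUnit.map _
  set x := σ u
  set y := algebraMap (𝓞 K) K u
  rcases Int.isUnit_iff.mp hN with h | h <;> rw [h] at hσ hK <;>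
    simp only [map_add, map_sub, map_mul, map_pow, map_intCast, map_zero] at hσ hK <;>
    push_cast at hσ hK
  · rcases lt_or_ge t 4 with h4 | h4
    · have ht2 : 2 < t := by
        by_contra! hle
        have : (t : ℝ) ≤ 2 := by exact_mod_cast hle
        nlinarith [sq_pos_of_pos (sub_pos.mpr hu)]
      obtain rfl : t = 3 := by omega
      exact absurd ⟨2 * y - 3, by push_cast at hK; linear_combination 4 * hK⟩ h5
    · have : (4 : ℝ) ≤ t := by exact_mod_cast h4
      left
      by_contra! hlt
      nlinarith
  · rcases lt_or_ge t 4 with h4 | h4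
    · have ht0 : 0 < t := by
        by_contra! hle
        have : (t : ℝ) ≤ 0 := by exact_mod_cast hle
        nlinarith
      interval_cases t <;> push_cast at hσ hK
      · exact absurd ⟨2 * y - 1, by linear_combination 4 * hK⟩ h5
      · exact absurd ⟨y - 1, by linear_combination hK⟩ h2
      · right
        constructor <;> norm_num <;> nlinarith
    · have : (4 : ℝ) ≤ t := by exact_mod_cast h4
      left
      by_contra! hlt
      nlinarith

lemma exists_ringHom_real_or_finite_units (hdeg : Module.finrank ℚ K = 2) :
    Nonempty (K →+* ℝ) ∨ Finite (𝓞 K)ˣ := by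
  classical
  have hcard := InfinitePlace.card_add_two_mul_card_eq_rank K
  have htot := InfinitePlace.card_eq_nrRealPlaces_add_nrComplexPlaces K
  by_cases h0 : InfinitePlace.nrRealPlaces K = 0
  · right
    have hrank : Units.rank K = 0 := by rw [Units.rank]; omega
    have : IsEmpty (Fin (Units.rank K)) := by rw [hrank]; infer_instance
    refine Finite.of_surjective (fun ζ : Units.torsion K ↦ (ζ : (𝓞 K)ˣ)) fun u ↦ ?_
    obtain ⟨⟨ζ, e⟩, hu, -⟩ := Units.exist_unique_eq_mul_prod K u
    exact ⟨ζ, by simpa using hu.symm⟩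
  · left
    obtain ⟨w, hw⟩ := Fintype.card_pos_iff.mp (Nat.pos_of_ne_zero h0)
    exact ⟨InfinitePlace.embedding_of_isReal hw⟩

lemma not_forall_eq_sum_units (hdeg : Module.finrank ℚ K = 2) (h2 : ¬ ∃ s : K, s ^ 2 = 2)
    (h5 : ¬ ∃ s : K, s ^ 2 = 5) :
    ¬ ∀ α : 𝓞 K, ∃ s : Finset (𝓞 K)ˣ, α = ∑ u ∈ s, (u : 𝓞 K) := by
  intro hall
  rcases exists_ringHom_real_or_finite_units hdeg with ⟨⟨τ⟩⟩ | hfin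
  · let σ : 𝓞 K →+* ℝ := τ.comp (algebraMap (𝓞 K) K)
    have hσ : Function.Injective σ := τ.injective.comp RingOfIntegers.coe_injective
    have hsmall (u : (𝓞 K)ˣ) (hu : 1 < |σ u|) : 3.7 ≤ |σ u| ∨ |σ u| ∈ Set.Icc 3.3 3.31 := by
      rcases le_total 0 (σ u) with h | h
      · rw [abs_of_nonneg h] at hu ⊢
        exact le_or_mem_Icc_of_one_lt hdeg h2 h5 σ u hu
      · rw [abs_of_nonpos h, ← map_neg, ← Units.val_neg] at hu ⊢
        exact le_or_mem_Icc_of_one_lt hdeg h2 h5 σ (-u) hu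
    have hratio (u : (𝓞 K)ˣ) (hu : 1 < |σ u|) : 3.3 ≤ |σ u| := by
      rcases hsmall u hu with h | h
      · linarith
      · exact h.1
    by_cases hex : ∃ ε : (𝓞 K)ˣ, |σ ε| ∈ Set.Icc (3.3 : ℝ) 3.31
    · obtain ⟨ε, hε⟩ := hex
      obtain ⟨s, hs⟩ := hall 5
      refine ne_sum_units_of_gap σ hσ (q := 3.3) (M := 3.31) (M' := 3.3 * 3.3) (by norm_num)
        (by norm_num) hratio (fun u ↦ ?_) ?_ ?_ s hs
      · have hu : |σ u| = |σ (u * ε⁻¹ : (𝓞 K)ˣ)| * |σ ε| := by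
          rw [← abs_mul, ← map_mul, ← Units.val_mul, inv_mul_cancel_right]
        rcases le_or_gt |σ (u * ε⁻¹ : (𝓞 K)ˣ)| 1 with h | h
        · left
          rw [hu]
          exact (mul_le_of_le_one_left (abs_nonneg _) h).trans hε.2
        · right
          rw [hu]
          exact mul_le_mul (hratio _ h) hε.1 (by norm_num) (abs_nonneg _)
      · rw [map_ofNat, abs_of_pos (by norm_num)]
        norm_num
      · rw [map_ofNat, abs_of_pos (by norm_num)]
        norm_num
    · have hbig (u : (𝓞 K)ˣ) (hu : 1 < |σ u|) : 3.7 ≤ |σ u| :=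
        (hsmall u hu).resolve_right fun h ↦ hex ⟨u, h⟩
      obtain ⟨s, hs⟩ := hall 2
      refine ne_sum_units_of_gap σ hσ (q := 3.7) (M := 1) (M' := 3.7) (by norm_num)
        zero_le_one hbig (fun u ↦ ?_) ?_ ?_ s hs
      · exact (le_or_gt |σ u| 1).imp_right (hbig u)
      all_goals
        rw [map_ofNat, abs_of_pos (by norm_num)]
        norm_num
  · have := Fintype.ofFinite (𝓞 K)ˣ
    have : Finite (𝓞 K) := Finite.of_surjective
      (fun s : Finset (𝓞 K)ˣ ↦ ∑ u ∈ s, (u : 𝓞 K)) fun α ↦ (hall α).imp fun _ h ↦ h.symm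
    exact not_finite (𝓞 K)

lemma exists_eq_add_mul_of_sq_eq (hdeg : Module.finrank ℚ K = 2) {d : ℤ} (hd : ¬ IsSquare d)
    {s : K} (hs : s ^ 2 = d) (x : K) : ∃ p q : ℚ, x = p + q * s := by
  have hli : LinearIndependent ℚ ![1, s] := by
    rw [LinearIndependent.pair_iff' one_ne_zero]
    intro r hr
    refine hd (Rat.isSquare_intCast_iff.mp ⟨r, (algebraMap ℚ K).injective ?_⟩)
    rw [Algebra.smul_def, mul_one] at hr
    rw [map_intCast, ← hs, map_mul, hr, sq]
  have hx : x ∈ Submodule.span ℚ (Set.range ![1, s]) := by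
    rw [hli.span_eq_top_of_card_eq_finrank (by simp [hdeg])]
    trivial
  rw [Matrix.range_cons, Matrix.range_cons, Matrix.range_empty, Set.union_empty,
    Set.singleton_union, Submodule.mem_span_pair] at hx
  obtain ⟨p, q, rfl⟩ := hx
  exact ⟨p, q, by simp [Algebra.smul_def]⟩

lemma exists_ringHom_real_of_sq_eq (hdeg : Module.finrank ℚ K = 2) {d : ℤ} (hd : ¬ IsSquare d)
    (hd0 : 0 < d) {s : K} (hs : s ^ 2 = d) : Nonempty (K →+* ℝ) := by
  obtain ⟨φ⟩ : Nonempty (K →+* ℂ) := inferInstance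
  have hφs : φ s ^ 2 = ((√d : ℝ) : ℂ) ^ 2 := by
    rw [← map_pow, hs, map_intCast, ← Complex.ofReal_pow,
      Real.sq_sqrt (by exact_mod_cast hd0.le), Complex.ofReal_intCast]
  have hconj : (starRingEnd ℂ) (φ s) = φ s := by
    rcases sq_eq_sq_iff_eq_or_eq_neg.mp hφs with h | h <;> rw [h] <;> simp
  have hreal : ComplexEmbedding.IsReal φ := by
    refine RingHom.ext fun x ↦ ?_
    obtain ⟨p, q, rfl⟩ := exists_eq_add_mul_of_sq_eq hdeg hd hs x
    simp [ComplexEmbedding.conjugate_coe_eq, hconj]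
  exact ⟨hreal.embedding⟩

lemma exists_int_of_isIntegral {q : ℚ} (h : IsIntegral ℤ q) : ∃ m : ℤ, q = m := by
  obtain ⟨m, hm⟩ := IsIntegrallyClosed.isIntegral_iff.mp h
  exact ⟨m, by simpa using hm.symm⟩

lemma exists_int_of_sq_eq {q : ℚ} {k : ℤ} (h : q ^ 2 = k) : ∃ m : ℤ, q = m :=
  exists_int_of_isIntegral (.of_pow two_pos (h ▸ isIntegral_algebraMap))

/-- The trace and norm of an integer `p + q √d` of a quadratic field are integers. -/
lemma exists_coordinates (hdeg : Module.finrank ℚ K = 2) {d : ℤ} (hd : ¬ IsSquare d)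
    {s : K} (hs : s ^ 2 = d) (x : 𝓞 K) :
    ∃ (p q : ℚ) (t n : ℤ),
      algebraMap (𝓞 K) K x = p + q * s ∧ 2 * p = t ∧ p ^ 2 - d * q ^ 2 = n := by
  obtain ⟨p, q, hx⟩ := exists_eq_add_mul_of_sq_eq hdeg hd hs (algebraMap (𝓞 K) K x)
  by_cases hq : q = 0
  · subst hq
    have hp : IsIntegral ℤ (algebraMap ℚ K p) := by
      have := RingOfIntegers.isIntegral_coe x
      rw [hx] at this
      simpa using this
    obtain ⟨m, rfl⟩ := exists_int_of_isIntegral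
      ((isIntegral_algebraMap_iff (algebraMap ℚ K).injective).mp hp)
    exact ⟨m, 0, 2 * m, m ^ 2, hx, by push_cast; ring, by push_cast; ring⟩
  · obtain ⟨t, ht⟩ := sq_sub_mul_add_norm_eq_zero hdeg x
    set n := Algebra.norm ℤ x
    have hK := congrArg (algebraMap (𝓞 K) K) ht
    simp only [map_add, map_sub, map_mul, map_pow, map_intCast, map_zero] at hK
    rw [hx] at hK
    have h2p : 2 * p = t := by
      by_contra hne
      have hne' : q * (2 * p - t) ≠ 0 := mul_ne_zero hq (sub_ne_zero.mpr hne)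
      refine hd (Rat.isSquare_intCast_iff.mp
        ⟨-(p ^ 2 + d * q ^ 2 - t * p + n) / (q * (2 * p - t)), (algebraMap ℚ K).injective ?_⟩)
      have hK' : s * algebraMap ℚ K (q * (2 * p - t)) =
          algebraMap ℚ K (-(p ^ 2 + d * q ^ 2 - t * p + n)) := by
        simp
        linear_combination hK - (q : K) ^ 2 * hs
      rw [map_mul, map_div₀, ← hK', mul_div_cancel_right₀ _
        ((map_ne_zero _).mpr hne'), map_intCast, ← hs, sq]
    refine ⟨p, q, t, n, hx, h2p, ?_⟩
    have h2p' : 2 * (p : K) = t := by exact_mod_cast congrArg (algebraMap ℚ K) h2p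
    have hfin : ((p ^ 2 - d * q ^ 2 : ℚ) : K) = ((n : ℚ) : K) := by
      push_cast
      linear_combination -hK + (q : K) ^ 2 * hs + (p + q * s) * h2p'
    exact_mod_cast hfin

lemma exists_eq_add_mul_sqrt_two (hdeg : Module.finrank ℚ K = 2) {s : 𝓞 K} (hs : s ^ 2 = 2)
    (x : 𝓞 K) : ∃ a b : ℤ, x = a + b * s := by
  obtain ⟨p, q, t, n, hx, hp, hn⟩ := exists_coordinates hdeg (d := 2)
    Int.prime_two.not_isSquare (s := algebraMap (𝓞 K) K s)
    (by rw [← map_pow, hs, map_ofNat, Int.cast_ofNat]) x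
  obtain ⟨m, hm⟩ := exists_int_of_sq_eq (q := 4 * q) (k := 2 * t ^ 2 - 8 * n) (by
    push_cast at hn ⊢
    rw [← hp, ← hn]
    ring)
  have hm2 : m ^ 2 = 2 * t ^ 2 - 8 * n := by
    have : (m : ℚ) ^ 2 = 2 * t ^ 2 - 8 * n := by
      push_cast at hn
      rw [← hm, ← hp, ← hn]
      ring
    exact_mod_cast this
  obtain ⟨k, rfl⟩ : (2 : ℤ) ∣ m := Int.prime_two.dvd_of_dvd_pow (n := 2) (by omega)
  have hk2 : 2 * k ^ 2 = t ^ 2 - 4 * n := by linarith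
  obtain ⟨l, rfl⟩ : (2 : ℤ) ∣ t := Int.prime_two.dvd_of_dvd_pow (n := 2) (by omega)
  have hl2 : k ^ 2 = 2 * l ^ 2 - 2 * n := by linarith
  obtain ⟨j, rfl⟩ : (2 : ℤ) ∣ k := Int.prime_two.dvd_of_dvd_pow (n := 2) (by omega)
  push_cast at hp hm
  obtain rfl : p = l := by linarith
  obtain rfl : q = j := by linarith
  exact ⟨l, j, RingOfIntegers.coe_injective (by simpa using hx)⟩

lemma exists_eq_add_mul_golden (hdeg : Module.finrank ℚ K = 2) {w : 𝓞 K} (hw : w ^ 2 = w + 1)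
    (x : 𝓞 K) : ∃ a b : ℤ, x = a + b * w := by
  have hwK := congrArg (algebraMap (𝓞 K) K) hw
  rw [map_pow, map_add, map_one] at hwK
  obtain ⟨p, q, t, n, hx, hp, hn⟩ := exists_coordinates hdeg (d := 5) Int.prime_five.not_isSquare
    (s := 2 * algebraMap (𝓞 K) K w - 1) (by push_cast; linear_combination 4 * hwK) x
  obtain ⟨m, hm⟩ := exists_int_of_sq_eq (q := 10 * q) (k := 5 * t ^ 2 - 20 * n) (by
    push_cast at hn ⊢
    rw [← hp, ← hn]
    ring)
  have hm2 : m ^ 2 = 5 * t ^ 2 - 20 * n := by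
    have : (m : ℚ) ^ 2 = 5 * t ^ 2 - 20 * n := by
      push_cast at hn
      rw [← hm, ← hp, ← hn]
      ring
    exact_mod_cast this
  obtain ⟨k, rfl⟩ : (5 : ℤ) ∣ m :=
    Int.prime_five.dvd_of_dvd_pow (n := 2) (by omega)
  have hk2 : 5 * k ^ 2 = t ^ 2 - 4 * n := by linarith
  have hpar : Even (t - k) := by
    have h : Even (t ^ 2 - k ^ 2) := by rw [even_iff_two_dvd]; omega
    rwa [Int.even_sub, Int.even_pow' two_ne_zero, Int.even_pow' two_ne_zero,
      ← Int.even_sub] at h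
  obtain ⟨j, hj⟩ := hpar
  obtain rfl : t = k + 2 * j := by omega
  push_cast at hp hm
  obtain rfl : p = k / 2 + j := by linarith
  obtain rfl : q = k / 2 := by linarith
  refine ⟨j, k, RingOfIntegers.coe_injective ?_⟩
  push_cast at hx
  rw [hx]
  simp
  ring

lemma forall_eq_sum_units_of_sq_eq_two (hdeg : Module.finrank ℚ K = 2) {s : K} (hs : s ^ 2 = 2)
    (α : 𝓞 K) : ∃ t : Finset (𝓞 K)ˣ, α = ∑ u ∈ t, (u : 𝓞 K) := by
  obtain ⟨τ⟩ := exists_ringHom_real_of_sq_eq hdeg (d := 2) Int.prime_two.not_isSquare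
    two_pos (s := s) (by exact_mod_cast hs)
  wlog hpos : 0 < τ s generalizing s
  · have hne : τ s ≠ 0 := (map_ne_zero τ).mpr (by rintro rfl; norm_num at hs)
    exact this (s := -s) (by rw [neg_sq, hs])
      (by rw [map_neg]; exact neg_pos.mpr (lt_of_le_of_ne (not_lt.mp hpos) hne))
  have hint : IsIntegral ℤ s := .of_pow two_pos (hs ▸ map_ofNat (algebraMap ℤ K) 2 ▸
    isIntegral_algebraMap)
  have hs' : (⟨s, hint⟩ : 𝓞 K) ^ 2 = 2 := RingOfIntegers.ext hs
  exact exists_eq_sum_units_of_sq_eq_two (τ.comp (algebraMap (𝓞 K) K)) hs' hpos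
    (exists_eq_add_mul_sqrt_two hdeg hs') α

lemma forall_eq_sum_units_of_sq_eq_five (hdeg : Module.finrank ℚ K = 2) {s : K} (hs : s ^ 2 = 5)
    (α : 𝓞 K) : ∃ t : Finset (𝓞 K)ˣ, α = ∑ u ∈ t, (u : 𝓞 K) := by
  obtain ⟨τ⟩ := exists_ringHom_real_of_sq_eq hdeg (d := 5) Int.prime_five.not_isSquare
    (by norm_num) (s := s) (by exact_mod_cast hs)
  wlog hpos : 0 < τ s generalizing s
  · have hne : τ s ≠ 0 := (map_ne_zero τ).mpr (by rintro rfl; norm_num at hs)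
    exact this (s := -s) (by rw [neg_sq, hs])
      (by rw [map_neg]; exact neg_pos.mpr (lt_of_le_of_ne (not_lt.mp hpos) hne))
  have hw : ((1 + s) / 2) ^ 2 = (1 + s) / 2 + 1 := by linear_combination hs / 4
  have hint : IsIntegral ℤ ((1 + s) / 2) :=
    ⟨.X ^ 2 - .X - 1, by monicity!, by simp [hw]⟩
  have hw' : (⟨(1 + s) / 2, hint⟩ : 𝓞 K) ^ 2 = ⟨(1 + s) / 2, hint⟩ + 1 := RingOfIntegers.ext hw
  refine exists_eq_sum_units_of_sq_eq_add_one (τ.comp (algebraMap (𝓞 K) K)) hw' ?_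
    (exists_eq_add_mul_golden hdeg hw') α
  change 0 < τ ((1 + s) / 2)
  simp only [map_div₀, map_add, map_one, map_ofNat]
  positivity

end NumberField

/-- Jacobson (1964), Śliwa (1974): a quadratic number field `K` is distinct
unit generated (every element of `𝓞 K` is a sum of pairwise distinct units)
if and only if `K` contains a square root of `2` or a square root of `5`
(i.e. `K = ℚ(√2)` or `K = ℚ(√5)`). -/
theorem quadratic_distinct_unit_generated (K : Type) [Field K] [NumberField K]
    (hdeg : Module.finrank ℚ K = 2) :
    (∀ α : 𝓞 K, ∃ s : Finset (𝓞 K)ˣ, α = ∑ u ∈ s, (u : 𝓞 K)) ↔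
      (∃ s : K, s ^ 2 = 2) ∨ (∃ s : K, s ^ 2 = 5) := by
  refine ⟨fun h ↦ ?_, ?_⟩
  · by_contra! hne
    exact not_forall_eq_sum_units hdeg (fun ⟨s, hs⟩ ↦ hne.1 s hs) (fun ⟨s, hs⟩ ↦ hne.2 s hs) h
  · rintro (⟨s, hs⟩ | ⟨s, hs⟩)
    · exact forall_eq_sum_units_of_sq_eq_two hdeg hs
    · exact forall_eq_sum_units_of_sq_eq_five hdeg hs
end

section
/- For every algebraic number field K there exists an algebraic number field L containing K (i.e., admitting a ℚ-algebra embedding of K into L) such that the ring of integers O_L of L is additively generated by its units: every element of O_L is a finite ℤ-linear combination of units of O_L, i.e. the additive subgroup of O_L generated by the set of units of O_L is all of O_L. -/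
open NumberField

/-- The ring of integers of `L` is additively generated by its units: every
element of `𝓞 L` is a finite `ℤ`-linear combination of units, i.e. the
additive subgroup of `𝓞 L` generated by the units is everything. -/
def RingOfIntegersGeneratedByUnits (L : Type) [Field L] : Prop :=
  AddSubgroup.closure {x : 𝓞 L | IsUnit x} = ⊤

/-- Points of the box `[0, X)^ι` that are pairwise at sup-distance at least `s` are few. -/
theorem card_mul_pow_le_of_separated {ι : Type*} [Fintype ι] [DecidableEq ι] {X s : ℕ}
    (E : Finset (ι → ℕ)) (hbox : ∀ b ∈ E, ∀ i, b i < X)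
    (hsep : ∀ b ∈ E, ∀ b' ∈ E, (∀ i, |(b i : ℤ) - b' i| < s) → b = b') :
    E.card * s ^ Fintype.card ι ≤ (X + s) ^ Fintype.card ι := by
  have key : (E ×ˢ Fintype.piFinset fun _ : ι => Finset.range s).card ≤
      (Fintype.piFinset fun _ : ι => Finset.range (X + s)).card := by
    refine Finset.card_le_card_of_injOn (fun q i => q.1 i + q.2 i) ?_ ?_
    · rintro ⟨b, r⟩ h
      simp only [Finset.coe_product, Set.mem_prod, Finset.mem_coe, Fintype.mem_piFinset,
        Finset.mem_range] at h ⊢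
      exact fun i => add_lt_add (hbox b h.1 i) (h.2 i)
    · rintro ⟨b, r⟩ h ⟨b', r'⟩ h' heq
      simp only [Finset.coe_product, Set.mem_prod, Finset.mem_coe, Fintype.mem_piFinset,
        Finset.mem_range] at h h'
      have heq' : ∀ i, b i + r i = b' i + r' i := fun i => congrFun heq i
      obtain rfl : b = b' := by
        refine hsep b h.1 b' h'.1 fun i => ?_
        have h1 := h.2 i
        have h2 := h'.2 i
        have h3 := heq' i
        rw [abs_lt]
        omega
      obtain rfl : r = r' := funext fun i => by simpa using heq' i
      rfl
  simpa [Finset.card_product, Fintype.card_piFinset] using key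

section
variable {M : Type*} [Field M] [NumberField M]

theorem exists_abs_norm_le {ι : Type*} [Fintype ι] (B : Module.Basis ι ℤ (𝓞 M)) :
    ∃ A : ℕ, 0 < A ∧ ∀ (H : ℕ) (x : 𝓞 M), (∀ i, |B.repr x i| ≤ H) →
      |Algebra.norm ℤ x| ≤ ((A * H) ^ Fintype.card ι : ℕ) := by
  obtain ⟨A, hA⟩ := exists_nat_ge (∑ σ : M →ₐ[ℚ] ℂ, ∑ i, ‖σ (B i)‖)
  refine ⟨A + 1, Nat.succ_pos _, fun H x hx => ?_⟩
  have hcard : Fintype.card (M →ₐ[ℚ] ℂ) = Fintype.card ι := by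
    rw [AlgHom.card, ← RingOfIntegers.rank, Module.finrank_eq_card_basis B]
  have hσ : ∀ σ : M →ₐ[ℚ] ℂ, ‖σ x‖ ≤ (A + 1) * H := by
    intro σ
    have hsum : (x : M) = ∑ i, (B.repr x i : M) * (B i : M) := by
      conv_lhs => rw [← B.sum_repr x]
      simp [zsmul_eq_mul]
    rw [hsum, map_sum]
    calc ‖∑ i, σ ((B.repr x i : M) * (B i : M))‖ ≤ ∑ i, ‖σ ((B.repr x i : M) * (B i : M))‖ :=
          norm_sum_le _ _
      _ ≤ ∑ i, (H : ℝ) * ‖σ (B i)‖ := by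
          refine Finset.sum_le_sum fun i _ => ?_
          rw [map_mul, norm_mul, map_intCast, Complex.norm_intCast]
          gcongr
          exact_mod_cast hx i
      _ = H * ∑ i, ‖σ (B i)‖ := by rw [Finset.mul_sum]
      _ ≤ H * A := by
          gcongr
          refine le_trans ?_ hA
          exact Finset.single_le_sum (f := fun σ : M →ₐ[ℚ] ℂ => ∑ i, ‖σ (B i)‖)
            (fun _ _ => Finset.sum_nonneg fun _ _ => norm_nonneg _) (Finset.mem_univ σ)
      _ ≤ (A + 1) * H := by nlinarith [Nat.cast_nonneg (α := ℝ) H]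
  have hn : ((|Algebra.norm ℤ x| : ℤ) : ℝ) ≤ ((A + 1) * H : ℝ) ^ Fintype.card ι := by
    have h1 : ((Algebra.norm ℤ x : ℤ) : ℂ) = ∏ σ : M →ₐ[ℚ] ℂ, σ x := by
      rw [← Algebra.norm_eq_prod_embeddings ℚ ℂ, ← Algebra.coe_norm_int]
      simp
    have h2 : ((|Algebra.norm ℤ x| : ℤ) : ℝ) = ‖((Algebra.norm ℤ x : ℤ) : ℂ)‖ := by
      rw [Complex.norm_intCast, Int.cast_abs]
    rw [h2, h1, norm_prod, ← hcard, ← Finset.card_univ]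
    rw [← Finset.prod_const]
    exact Finset.prod_le_prod (fun _ _ => norm_nonneg _) fun σ _ => hσ σ
  exact_mod_cast hn

theorem Ideal.IsPrime.dvd_absNorm_of_natCast_mem {P : Ideal (𝓞 M)} (hP : P.IsPrime) {p : ℕ}
    (hp : p.Prime) (hpP : (p : 𝓞 M) ∈ P) : p ∣ Ideal.absNorm P := by
  have h1 : Ideal.absNorm P ∣ p ^ Module.finrank ℤ (𝓞 M) := by
    have := Ideal.absNorm_dvd_norm_of_mem hpP
    rw [← Int.natCast_dvd_natCast]
    convert this using 1
    have := Algebra.norm_algebraMap_of_basis (RingOfIntegers.basis M) (p : ℤ)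
    rw [← Module.finrank_eq_card_basis (RingOfIntegers.basis M)] at this
    push_cast
    rw [← this]
    simp
  obtain ⟨k, -, hk⟩ := (Nat.dvd_prime_pow hp).1 h1
  rcases k with _ | k
  · exact absurd (Ideal.absNorm_eq_one_iff.1 (by simpa using hk)) hP.ne_top
  · rw [hk]
    exact dvd_pow_self _ k.succ_ne_zero

theorem card_le_finrank_of_prime_mem {p : ℕ} (hp : p.Prime) (S : Finset (Ideal (𝓞 M)))
    (hS : ∀ P ∈ S, P.IsPrime ∧ (p : 𝓞 M) ∈ P) : S.card ≤ Module.finrank ℤ (𝓞 M) := by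
  have h0 : ∀ P ∈ S, P ≠ ⊥ := by
    rintro P hPS rfl
    have := (hS _ hPS).2
    simp [hp.ne_zero] at this
  have hdvd : ∏ P ∈ S, P ∣ Ideal.span {(p : 𝓞 M)} := by
    refine Finset.prod_dvd_of_coprime ?_ ?_
    · intro P hP Q hQ hne
      have := ((hS P hP).1.isMaximal (h0 P hP))
      have := ((hS Q hQ).1.isMaximal (h0 Q hQ))
      exact Ideal.isCoprime_iff_sup_eq.2 (Ideal.IsMaximal.coprime_of_ne ‹_› ‹_› hne)
    · intro P hP
      rw [Ideal.dvd_span_singleton]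
      exact (hS P hP).2
  have h1 : Ideal.absNorm (∏ P ∈ S, P) ∣ p ^ Module.finrank ℤ (𝓞 M) := by
    have := Ideal.absNorm_dvd_absNorm_of_le (Ideal.dvd_iff_le.1 hdvd)
    refine this.trans (dvd_of_eq ?_)
    rw [Ideal.absNorm_span_singleton]
    have := Algebra.norm_algebraMap_of_basis (RingOfIntegers.basis M) (p : ℤ)
    rw [← Module.finrank_eq_card_basis (RingOfIntegers.basis M)] at this
    simp only [eq_intCast, Int.cast_natCast] at this
    rw [this]
    simp [Int.natAbs_pow]
  have h2 : p ^ S.card ∣ Ideal.absNorm (∏ P ∈ S, P) := by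
    rw [map_prod, ← Finset.prod_const]
    exact Finset.prod_dvd_prod_of_dvd _ _ fun P hP =>
      (hS P hP).1.dvd_absNorm_of_natCast_mem hp (hS P hP).2
  exact (Nat.pow_dvd_pow_iff_le_right hp.one_lt).1 (h2.trans h1)

theorem exists_prime_natCast_mem {P : Ideal (𝓞 M)} (hP : P.IsPrime) (h0 : P ≠ ⊥) :
    ∃ p : ℕ, p.Prime ∧ (p : 𝓞 M) ∈ P := by
  have hne : Ideal.absNorm P ≠ 0 := by simpa [Ideal.absNorm_eq_zero_iff] using h0
  have hmem := Ideal.absNorm_mem P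
  rw [← Nat.prod_primeFactorsList hne, Nat.cast_list_prod, ← Multiset.prod_coe] at hmem
  obtain ⟨x, hx, hxP⟩ := (hP.multiset_prod_mem_iff_exists_mem _).1 hmem
  obtain ⟨p, hp, rfl⟩ := List.mem_map.1 (Multiset.mem_coe.1 hx)
  exact ⟨p, Nat.prime_of_mem_primeFactorsList hp, hxP⟩

theorem Ideal.IsPrime.sq_le_abs_norm {P : Ideal (𝓞 M)} (hP : P.IsPrime) {p : ℕ}
    (hp : p.Prime) (hpP : (p : 𝓞 M) ∈ P) {x : 𝓞 M} (hx : x ∈ P ^ 2) (hx0 : x ≠ 0) :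
    (p ^ 2 : ℤ) ≤ |Algebra.norm ℤ x| := by
  have h1 : ((p ^ 2 : ℕ) : ℤ) ∣ Algebra.norm ℤ x := by
    refine dvd_trans ?_ (Ideal.absNorm_dvd_norm_of_mem hx)
    rw [map_pow]
    exact_mod_cast pow_dvd_pow_of_dvd (hP.dvd_absNorm_of_natCast_mem hp hpP) 2
  have h2 : Algebra.norm ℤ x ≠ 0 := Algebra.norm_ne_zero_iff.2 hx0
  have := Int.le_of_dvd (abs_pos.2 h2) ((dvd_abs _ _).2 h1)
  exact_mod_cast this

theorem card_le_of_mem_prime_sq {ι : Type*} [Fintype ι] [DecidableEq ι]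
    (B : Module.Basis ι ℤ (𝓞 M)) {A : ℕ}
    (hA : ∀ (H : ℕ) (x : 𝓞 M), (∀ i, |B.repr x i| ≤ H) →
      |Algebra.norm ℤ x| ≤ ((A * H) ^ Fintype.card ι : ℕ))
    (hA0 : 0 < A) (hι : Fintype.card ι ≠ 0) {P : Ideal (𝓞 M)} (hP : P.IsPrime) {p : ℕ}
    (hp : p.Prime) (hpP : (p : 𝓞 M) ∈ P) (hpA : A ^ Fintype.card ι < p ^ 2)
    {m : ℕ} (hm : (m : 𝓞 M) ∉ P) (c : 𝓞 M) {X : ℕ} (E : Finset (ι → ℕ))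
    (hbox : ∀ b ∈ E, ∀ i, b i < X)
    (hE : ∀ b ∈ E, c + m * ∑ i, (b i : ℤ) • B i ∈ P ^ 2) :
    (E.card : ℝ) ≤ 1 + (4 * A * X : ℝ) ^ Fintype.card ι * ((p : ℝ) ^ 2)⁻¹ := by
  set n := Fintype.card ι
  have hp0 : 0 < p ^ 2 := pow_pos hp.pos 2
  have hex : ∃ k : ℕ, p ^ 2 ≤ (A * (k + 1)) ^ n := by
    refine ⟨p ^ 2, le_trans ?_ (Nat.le_self_pow hι _)⟩
    nlinarith
  obtain ⟨s, hs1, hs2⟩ : ∃ s : ℕ, (A * s) ^ n < p ^ 2 ∧ p ^ 2 ≤ (A * (s + 1)) ^ n := by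
    refine ⟨Nat.find hex, ?_, Nat.find_spec hex⟩
    rcases hk : Nat.find hex with _ | k
    · rw [mul_zero, zero_pow hι]
      exact hp0
    · have := Nat.find_min hex (m := k) (by omega)
      omega
  have hs0 : 1 ≤ s := by
    by_contra hcon
    obtain rfl : s = 0 := by omega
    simp only [zero_add, mul_one] at hs2
    omega
  have hsep : ∀ b ∈ E, ∀ b' ∈ E, (∀ i, |(b i : ℤ) - b' i| ≤ s) → b = b' := by
    intro b hb b' hb' h
    by_contra hne
    set x : 𝓞 M := ∑ i, ((b i : ℤ) - b' i) • B i with hx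
    have hrepr : ∀ i, B.repr x i = (b i : ℤ) - b' i := fun i => by
      rw [hx, B.repr_sum_self]
    have hx0 : x ≠ 0 := by
      intro h0
      refine hne (funext fun i => ?_)
      have := hrepr i
      rw [h0] at this
      simp only [map_zero, Finsupp.coe_zero, Pi.zero_apply] at this
      omega
    have hxP : x ∈ P ^ 2 := by
      have hmx : (m : 𝓞 M) * x ∈ P ^ 2 := by
        have := sub_mem (hE b hb) (hE b' hb')
        convert this using 1
        simp only [hx, sub_smul, Finset.sum_sub_distrib]
        ring
      exact (hP.mul_mem_pow _ hmx).resolve_left hm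
    have h1 := hP.sq_le_abs_norm hp hpP hxP hx0
    have h2 := hA s x fun i => by rw [hrepr]; exact h i
    have : p ^ 2 ≤ (A * s) ^ n := by exact_mod_cast h1.trans h2
    omega
  have hpos : (0 : ℝ) < (p : ℝ) ^ 2 := by exact_mod_cast hp0
  rcases le_or_gt s X with hsX | hsX
  · have h1 := card_mul_pow_le_of_separated (s := s) E hbox
      fun b hb b' hb' h => hsep b hb b' hb' fun i => (h i).le
    have h2 : p ^ 2 ≤ (2 * A * s) ^ n := hs2.trans (Nat.pow_le_pow_left (by nlinarith) _)
    have h3 : E.card * p ^ 2 ≤ (4 * A * X) ^ n := by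
      calc E.card * p ^ 2 ≤ E.card * (2 * A * s) ^ n := by gcongr
        _ = (2 * A) ^ n * (E.card * s ^ n) := by rw [mul_pow]; ring
        _ ≤ (2 * A) ^ n * (X + s) ^ n := by gcongr
        _ ≤ (2 * A) ^ n * (2 * X) ^ n := by gcongr; omega
        _ = (4 * A * X) ^ n := by rw [← mul_pow]; congr 1; ring
    have h4 : (E.card : ℝ) * (p : ℝ) ^ 2 ≤ (4 * A * X : ℝ) ^ n := by exact_mod_cast h3
    rw [← div_eq_mul_inv]
    have := (le_div_iff₀ hpos).2 h4
    linarith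
  · have : E.card ≤ 1 := Finset.card_le_one.2 fun b hb b' hb' => hsep b hb b' hb' fun i => by
      have h1 := hbox b hb i
      have h2 := hbox b' hb' i
      rw [abs_le]
      omega
    have h1 : (E.card : ℝ) ≤ 1 := by exact_mod_cast this
    have : 0 ≤ (4 * A * X : ℝ) ^ n * ((p : ℝ) ^ 2)⁻¹ := by positivity
    linarith

variable (M) in
theorem exists_forall_sq_sub_four_notMem_prime_sq :
    ∃ T : ℕ, ∀ m : ℕ, 1 < m → (∀ p : ℕ, p.Prime → p ≤ T → p ∣ m) → ∀ γ : 𝓞 M,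
      IsCoprime (γ ^ 2 - 4) (m : 𝓞 M) →
      ∃ β : 𝓞 M, ∀ P : Ideal (𝓞 M), P.IsPrime → P ≠ ⊥ → (γ + m * β) ^ 2 - 4 ∉ P ^ 2 := by
  classical
  let B := RingOfIntegers.basis M
  set ι := Module.Free.ChooseBasisIndex ℤ (𝓞 M)
  obtain ⟨A, hA0, hA⟩ := exists_abs_norm_le B
  set n := Fintype.card ι with hn
  have hfin : Module.finrank ℤ (𝓞 M) = n := Module.finrank_eq_card_basis B
  have hn0 : n ≠ 0 := by
    rw [← hfin, RingOfIntegers.rank]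
    exact Module.finrank_pos.ne'
  let T := max 2 (max (A ^ n) (8 * n * (4 * A) ^ n))
  have hT2 : 2 ≤ T := le_max_left _ _
  have hTA : A ^ n ≤ T := (le_max_left _ _).trans (le_max_right _ _)
  have hTn : 8 * n * (4 * A) ^ n ≤ T := (le_max_right _ _).trans (le_max_right _ _)
  refine ⟨T, fun m hm1 hmT γ hγ => ?_⟩
  by_contra! hbad
  obtain ⟨G, hG⟩ : ∃ G : ℕ, ∀ a ∈ ({2, -2} : Finset ℤ), ∀ i, |B.repr (γ - a) i| ≤ G := by
    refine ⟨∑ a ∈ ({2, -2} : Finset ℤ), ∑ i, (B.repr (γ - a) i).natAbs, fun a ha i => ?_⟩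
    rw [Int.abs_eq_natAbs]
    have h1 := Finset.single_le_sum (f := fun i => (B.repr (γ - a) i).natAbs)
      (fun _ _ => Nat.zero_le _) (Finset.mem_univ i)
    have h2 := Finset.single_le_sum (f := fun a : ℤ => ∑ i, (B.repr (γ - a) i).natAbs)
      (fun _ _ => Nat.zero_le _) ha
    exact_mod_cast h1.trans h2
  let C := (A * (G + m)) ^ n
  let Y := 8 * n * (A * (G + m))
  let Q := C * Y ^ n
  let X := Y ^ 2
  have hY0 : 0 < Y := by positivity
  let vec : (ι → ℕ) → 𝓞 M := fun b => ∑ i, (b i : ℤ) • B i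
  let Box : Finset (ι → ℕ) := Fintype.piFinset fun _ => Finset.range X
  have hBox : Box.card = X ^ n := by simp [Box, Fintype.card_piFinset, hn]
  have hprimes : ∀ p : ℕ, p.Prime → {P : Ideal (𝓞 M) | P.IsPrime ∧ (p : 𝓞 M) ∈ P}.Finite := by
    intro p hp
    by_contra hinf
    obtain ⟨S, hS, hcard⟩ := Set.Infinite.exists_subset_card_eq hinf (n + 1)
    have := card_le_finrank_of_prime_mem hp S fun P hP => hS hP
    omega
  let S : ℕ → Finset (Ideal (𝓞 M)) := fun p =>
    if hp : p.Prime then (hprimes p hp).toFinset else ∅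
  have hS : ∀ p P, P ∈ S p ↔ p.Prime ∧ P.IsPrime ∧ (p : 𝓞 M) ∈ P := by
    intro p P
    by_cases hp : p.Prime <;> simp [S, hp]
  have hScard : ∀ p, (S p).card ≤ n := by
    intro p
    by_cases hp : p.Prime
    · rw [← hfin]
      exact card_le_finrank_of_prime_mem hp _ fun P hP => ((hS p P).1 hP).2
    · simp [S, hp]
  let E : ℤ → ℕ → Ideal (𝓞 M) → Finset (ι → ℕ) := fun a p P =>
    {b ∈ Box | (m : 𝓞 M) ∉ P ∧ γ - a + m * vec b ∈ P ^ 2}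
  have hcover : Box ⊆ ({2, -2} : Finset ℤ).biUnion fun a =>
      (Finset.Ioc T (max T Q)).biUnion fun p => (S p).biUnion fun P => E a p P := by
    intro b hb
    obtain ⟨P, hP, hP0, hPb⟩ := hbad (vec b)
    have hmP : (m : 𝓞 M) ∉ P := by
      intro hmem
      obtain ⟨u, v, huv⟩ := hγ
      refine hP.ne_top ((Ideal.eq_top_iff_one _).2 ?_)
      have h1 := Ideal.pow_le_self two_ne_zero hPb
      have : (1 : 𝓞 M) = u * ((γ + m * vec b) ^ 2 - 4) +
          (v - u * (2 * γ * vec b + m * vec b ^ 2)) * m := by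
        rw [← huv]; ring
      rw [this]
      exact add_mem (P.mul_mem_left _ h1) (P.mul_mem_left _ hmem)
    obtain ⟨a, ha, haP⟩ : ∃ a ∈ ({2, -2} : Finset ℤ), γ - a + m * vec b ∈ P ^ 2 := by
      have hfac : (γ + m * vec b) ^ 2 - 4 =
          (γ - (2 : ℤ) + m * vec b) * (γ - (-2 : ℤ) + m * vec b) := by
        push_cast; ring
      rw [hfac] at hPb
      rcases hP.mul_mem_pow _ hPb with h1 | h1
      · refine ⟨2, by simp, (hP.mem_pow_mul _ hPb).resolve_right fun h2 => hmP ?_⟩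
        have h4 : (2 : 𝓞 M) * 2 ∈ P := by
          convert sub_mem h2 h1 using 1
          push_cast; ring
        have h2P : (2 : 𝓞 M) ∈ P := (hP.mem_or_mem h4).elim id id
        obtain ⟨k, hk⟩ := hmT 2 Nat.prime_two hT2
        rw [hk]
        push_cast
        exact P.mul_mem_right _ h2P
      · exact ⟨-2, by simp, h1⟩
    obtain ⟨p, hp, hpP⟩ := exists_prime_natCast_mem hP hP0
    have hpT : T < p := by
      by_contra! hle
      obtain ⟨k, hk⟩ := hmT p hp hle
      refine hmP ?_
      rw [hk]
      push_cast
      exact P.mul_mem_right _ hpP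
    have hz : γ - a + m * vec b ≠ 0 := by
      intro hz
      obtain ⟨u, v, huv⟩ := hγ
      have hunit : (m : 𝓞 M) * (v - u * (2 * γ * vec b + m * vec b ^ 2)) = 1 := by
        have h4 : (γ + m * vec b) ^ 2 - 4 = 0 := by
          have : γ + m * vec b = a := by linear_combination hz
          rw [this]
          simp only [Finset.mem_insert, Finset.mem_singleton] at ha
          rcases ha with rfl | rfl <;> push_cast <;> ring
        linear_combination huv - u * h4
      have : (m : ℤ) ^ n ∣ 1 := by
        refine ⟨Algebra.norm ℤ (v - u * (2 * γ * vec b + m * vec b ^ 2)), ?_⟩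
        rw [← map_one (Algebra.norm ℤ (S := 𝓞 M)), ← hunit, map_mul]
        congr 1
        have := Algebra.norm_algebraMap_of_basis B (m : ℤ)
        simpa using this
      have h1 : m ^ n ∣ 1 := by exact_mod_cast this
      rw [Nat.dvd_one, Nat.pow_eq_one] at h1
      omega
    have hbX : ∀ i, b i < X := by simpa [Box] using hb
    have hpQ : p ≤ Q := by
      have h1 := hP.sq_le_abs_norm hp hpP haP hz
      have h2 := hA ((G + m) * X) (γ - a + m * vec b) fun i => by
        have hr : B.repr (γ - a + m * vec b) i = B.repr (γ - a) i + m * b i := by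
          have : (m : 𝓞 M) * vec b = (m : ℤ) • vec b := by simp
          rw [map_add, this, map_smul, Finsupp.add_apply, Finsupp.smul_apply, B.repr_sum_self]
          rfl
        rw [hr]
        have hg := hG a ha i
        have hX1 : 1 ≤ X := Nat.one_le_pow _ _ hY0
        have hb1 : (b i : ℤ) ≤ X := by exact_mod_cast (hbX i).le
        calc |B.repr (γ - a) i + m * b i| ≤ |B.repr (γ - a) i| + |(m * b i : ℤ)| := abs_add_le _ _
          _ ≤ G + m * X := by
            rw [abs_of_nonneg (by positivity : (0 : ℤ) ≤ m * b i)]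
            gcongr
          _ ≤ ((G + m) * X : ℕ) := by
            push_cast
            have : (1 : ℤ) ≤ X := by exact_mod_cast hX1
            nlinarith [Nat.cast_nonneg (α := ℤ) G]
      have h3 : p ^ 2 ≤ (A * ((G + m) * X)) ^ n := by exact_mod_cast h1.trans h2
      have hC : 1 ≤ C := Nat.one_le_pow _ _ (by positivity)
      have h4 : (A * ((G + m) * X)) ^ n = C * (Y ^ n) ^ 2 := by
        simp only [C, X]
        rw [← mul_assoc, mul_pow, ← pow_mul, ← pow_mul, mul_comm 2 n]
      have h5 : p ^ 2 ≤ Q ^ 2 := by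
        rw [h4] at h3
        refine h3.trans ?_
        simp only [Q, mul_pow]
        gcongr
        nlinarith
      exact (Nat.pow_le_pow_iff_left two_ne_zero).1 h5
    simp only [Finset.mem_biUnion, E, Finset.mem_filter]
    exact ⟨a, ha, p, Finset.mem_Ioc.2 ⟨hpT, hpQ.trans (le_max_right _ _)⟩, P,
      (hS p P).2 ⟨hp, hP, hpP⟩, hb, hmP, haP⟩
  have hE : ∀ a, ∀ p ∈ Finset.Ioc T (max T Q), ∀ P ∈ S p,
      ((E a p P).card : ℝ) ≤ 1 + (4 * A * X : ℝ) ^ n * ((p : ℝ) ^ 2)⁻¹ := by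
    intro a p hpT P hPS
    obtain ⟨hp, hP, hpP⟩ := (hS p P).1 hPS
    by_cases hmP : (m : 𝓞 M) ∈ P
    · have : (E a p P).card = 0 := by simp [E, hmP]
      rw [this]
      push_cast
      positivity
    · refine card_le_of_mem_prime_sq B hA hA0 hn0 hP hp hpP ?_ hmP (γ - a) _ ?_ ?_
      · have := (Finset.mem_Ioc.1 hpT).1
        nlinarith
      · intro b hb
        simpa [Box] using (Finset.mem_filter.1 hb).1
      · intro b hb
        exact (Finset.mem_filter.1 hb).2.2
  have hXn : (0 : ℝ) < (X : ℝ) ^ n := by positivity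
  have hcount : (X : ℝ) ^ n ≤ 2 * (n * (Q + (4 * A * X : ℝ) ^ n * (T : ℝ)⁻¹)) := by
    have h1 : ((X ^ n : ℕ) : ℝ) ≤ ∑ a ∈ ({2, -2} : Finset ℤ), ∑ p ∈ Finset.Ioc T (max T Q),
        ∑ P ∈ S p, ((E a p P).card : ℝ) := by
      rw [← hBox]
      refine le_trans (Nat.cast_le.2 ((Finset.card_le_card hcover).trans
        (Finset.card_biUnion_le.trans (Finset.sum_le_sum fun a _ => Finset.card_biUnion_le.trans
          (Finset.sum_le_sum fun p _ => Finset.card_biUnion_le))))) ?_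
      push_cast
      rfl
    have h2 : ∀ a, ∑ p ∈ Finset.Ioc T (max T Q), ∑ P ∈ S p, ((E a p P).card : ℝ) ≤
        n * (Q + (4 * A * X : ℝ) ^ n * (T : ℝ)⁻¹) := by
      intro a
      calc ∑ p ∈ Finset.Ioc T (max T Q), ∑ P ∈ S p, ((E a p P).card : ℝ)
          ≤ ∑ p ∈ Finset.Ioc T (max T Q), n * (1 + (4 * A * X : ℝ) ^ n * ((p : ℝ) ^ 2)⁻¹) := by
            refine Finset.sum_le_sum fun p hp => ?_
            refine (Finset.sum_le_sum (hE a p hp)).trans ?_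
            rw [Finset.sum_const, nsmul_eq_mul]
            have := hScard p
            gcongr
        _ = n * ((Finset.Ioc T (max T Q)).card + (4 * A * X : ℝ) ^ n *
              ∑ p ∈ Finset.Ioc T (max T Q), ((p : ℝ) ^ 2)⁻¹) := by
            rw [← Finset.mul_sum, Finset.sum_add_distrib, ← Finset.mul_sum]
            simp
        _ ≤ n * (Q + (4 * A * X : ℝ) ^ n * (T : ℝ)⁻¹) := by
            have h3 := sum_Ioc_inv_sq_le_sub (α := ℝ) (k := T) (n := max T Q) (by omega)
              (le_max_left _ _)
            have h4 : (Finset.Ioc T (max T Q)).card ≤ Q := by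
              rw [Nat.card_Ioc]; omega
            have h5 : (0 : ℝ) ≤ ((max T Q : ℕ) : ℝ)⁻¹ := by positivity
            have h6 : ∑ p ∈ Finset.Ioc T (max T Q), ((p : ℝ) ^ 2)⁻¹ ≤ (T : ℝ)⁻¹ := by linarith
            gcongr
    push_cast at h1
    refine h1.trans ((Finset.sum_le_sum fun a _ => h2 a).trans ?_)
    rw [Finset.sum_const, nsmul_eq_mul]
    norm_num
  have hQ : 8 * n * Q ≤ X ^ n := by
    have h1 : 8 * n * C ≤ Y ^ n := by
      simp only [Y, C, mul_pow _ (A * (G + m))]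
      exact Nat.mul_le_mul_right _ (Nat.le_self_pow hn0 _)
    calc 8 * n * Q = 8 * n * C * Y ^ n := (mul_assoc _ _ _).symm
      _ ≤ Y ^ n * Y ^ n := by gcongr
      _ = X ^ n := by rw [← pow_add, ← pow_mul, two_mul]
  have hT' : 8 * n * ((4 * A * X : ℝ) ^ n * (T : ℝ)⁻¹) ≤ (X : ℝ) ^ n := by
    have hTpos : (0 : ℝ) < T := by positivity
    rw [← div_eq_mul_inv, ← mul_div_assoc, div_le_iff₀ hTpos, mul_pow]
    have : (8 * n * (4 * A) ^ n : ℝ) ≤ T := by exact_mod_cast hTn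
    nlinarith
  have hQ' : (8 * n * Q : ℝ) ≤ (X : ℝ) ^ n := by exact_mod_cast hQ
  linarith

theorem exists_sq_sub_four_notMem_prime_sq {m : ℕ} (hm0 : 0 < m) (hm2 : 2 ∣ m) {γ : 𝓞 M}
    (hγ : IsCoprime (γ ^ 2 - 4) (m : 𝓞 M)) :
    ∃ β : 𝓞 M, ∀ P : Ideal (𝓞 M), P.IsPrime → P ≠ ⊥ → (γ + m * β) ^ 2 - 4 ∉ P ^ 2 := by
  obtain ⟨T, hT⟩ := exists_forall_sq_sub_four_notMem_prime_sq M
  set N := ∏ p ∈ (Finset.range (T + 1)).filter fun p => p.Prime ∧ ¬ p ∣ m, p with hN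
  have hNm : Nat.Coprime m N := by
    refine Nat.Coprime.prod_right fun p hp => ?_
    obtain ⟨-, hp, hpm⟩ := Finset.mem_filter.1 hp
    exact ((Nat.Prime.coprime_iff_not_dvd hp).2 hpm).symm
  have hN0 : 0 < N := Finset.prod_pos fun p hp => (Finset.mem_filter.1 hp).2.1.pos
  obtain ⟨x, hx1, hx0⟩ := Nat.chineseRemainder hNm 1 0
  obtain ⟨k, hk⟩ : (m : ℤ) ∣ x - 1 := (Nat.modEq_iff_dvd.1 hx1.symm)
  obtain ⟨l, hl⟩ := (Nat.modEq_zero_iff_dvd.1 hx0)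
  have hk' : (x : 𝓞 M) = 1 + m * (k : 𝓞 M) := by
    have : (x : ℤ) = 1 + m * k := by linarith
    exact_mod_cast congrArg (Int.cast : ℤ → 𝓞 M) this
  have hl' : (x : 𝓞 M) = N * (l : 𝓞 M) := by exact_mod_cast congrArg (Nat.cast : ℕ → 𝓞 M) hl
  have hcop : IsCoprime ((x * γ) ^ 2 - 4) ((m * N : ℕ) : 𝓞 M) := by
    rw [Nat.cast_mul]
    refine IsCoprime.mul_right ?_ ?_
    · have : (x * γ) ^ 2 - 4 = γ ^ 2 - 4 + m * ((k : 𝓞 M) * (2 + m * k) * γ ^ 2) := by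
        rw [hk']; ring
      rw [this]
      exact hγ.add_mul_left_left _
    · have : (x * γ) ^ 2 - 4 = -4 + N * ((l : 𝓞 M) * x * γ ^ 2) := by
        linear_combination ((x : 𝓞 M) * γ ^ 2) * hl'
      rw [this]
      refine IsCoprime.add_mul_left_left ?_ _
      have h2 : Nat.Coprime 4 N := by
        have : Nat.Coprime 2 N := Nat.Coprime.coprime_dvd_left hm2 hNm
        exact Nat.Coprime.pow_left 2 this
      have := (Nat.isCoprime_iff_coprime.2 h2).map (Int.castRingHom (𝓞 M))
      simpa using this.neg_left
  obtain ⟨β, hβ⟩ := hT (m * N) (by have := Nat.le_of_dvd hm0 hm2; nlinarith) (fun p hp hpT => by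
    by_cases hpm : p ∣ m
    · exact hpm.mul_right N
    · refine Dvd.dvd.mul_left (Finset.dvd_prod_of_mem _ ?_) m
      exact Finset.mem_filter.2 ⟨Finset.mem_range.2 (by omega), hp, hpm⟩) _ hcop
  refine ⟨k * γ + N * β, fun P hP hP0 => ?_⟩
  have h := hβ P hP hP0
  have heq : (γ + m * (k * γ + N * β) : 𝓞 M) = x * γ + (m * N : ℕ) * β := by
    rw [hk']
    push_cast
    ring
  rwa [heq]

theorem exists_sq_ne_four_and_sub_sq_ne_four {F : Type*} [Field F] {e : F} (he : e ^ 3 - e = 1)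
    (g : F) : ∃ a : F, a ^ 2 - 4 ≠ 0 ∧ (g - a) ^ 2 - 4 ≠ 0 := by
  classical
  have he0 : e ≠ 0 := by rintro rfl; simp at he
  have he1 : e ≠ 1 := by rintro rfl; simp at he
  have he1' : e ≠ -1 := by rintro rfl; norm_num at he
  by_cases h2 : (2 : F) = 0
  · have h4 : (4 : F) = 0 := by linear_combination 2 * h2
    simp only [h4, sub_zero, ne_eq, pow_eq_zero_iff two_ne_zero]
    by_cases hg : g = 1
    · exact ⟨e, he0, by rw [hg]; exact fun h => he1 (sub_eq_zero.1 h).symm⟩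
    · exact ⟨1, one_ne_zero, sub_ne_zero.2 hg⟩
  · by_contra! hcon
    have hne : ∀ x : F, x ≠ 0 → x ≠ -x := fun x hx h =>
      (mul_ne_zero h2 hx) (by linear_combination h)
    have hsub : ({0, 1, -1, e, -e} : Finset F) ⊆ {2, -2, g - 2, g + 2} := by
      intro a _
      simp only [Finset.mem_insert, Finset.mem_singleton]
      by_cases ha : a ^ 2 - 4 = 0
      · have : (a - 2) * (a + 2) = 0 := by linear_combination ha
        rcases mul_eq_zero.1 this with h | h
        · exact Or.inl (sub_eq_zero.1 h)
        · exact Or.inr (Or.inl (eq_neg_of_add_eq_zero_left h))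
      · have : (g - a - 2) * (g - a + 2) = 0 := by linear_combination hcon a ha
        rcases mul_eq_zero.1 this with h | h
        · exact Or.inr (Or.inr (Or.inl (by linear_combination -h)))
        · exact Or.inr (Or.inr (Or.inr (by linear_combination -h)))
    have h5 : ({0, 1, -1, e, -e} : Finset F).card = 5 := by
      have h1 := hne 1 one_ne_zero
      have he := hne e he0
      have h6 : (1 : F) ≠ -e := fun h => he1' (by rw [h, neg_neg])
      have h7 : (-1 : F) ≠ -e := fun h => he1 (neg_injective h).symm
      rw [Finset.card_insert_of_notMem, Finset.card_insert_of_notMem,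
        Finset.card_insert_of_notMem, Finset.card_insert_of_notMem, Finset.card_singleton] <;>
      simp only [Finset.mem_insert, Finset.mem_singleton, not_or, zero_eq_neg,
        zero_ne_one, one_ne_zero, not_false_eq_true, true_and]
      · exact he
      · exact ⟨he1'.symm, h7⟩
      · exact ⟨h1, he1.symm, h6⟩
      · exact ⟨he0.symm, he0⟩
    have := Finset.card_le_card hsub
    have h4 : ({2, -2, g - 2, g + 2} : Finset F).card ≤ 4 := Finset.card_le_four
    omega

theorem exists_isCoprime_sq_sub_four {e : 𝓞 M} (he : e ^ 3 - e = 1) {m : ℕ} (hm0 : 0 < m)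
    (γ : 𝓞 M) : ∃ α : 𝓞 M, IsCoprime (α ^ 2 - 4) (m : 𝓞 M) ∧
      IsCoprime ((γ - α) ^ 2 - 4) (m : 𝓞 M) := by
  have hm : (m : 𝓞 M) ≠ 0 := Nat.cast_ne_zero.2 hm0.ne'
  let S := {P : Ideal (𝓞 M) // P.IsMaximal ∧ (m : 𝓞 M) ∈ P}
  have : Finite S := by
    have hspan : Ideal.span {(m : 𝓞 M)} ≠ 0 := by simpa using hm
    have : Finite {v : IsDedekindDomain.HeightOneSpectrum (𝓞 M) //
        v.asIdeal ∣ Ideal.span {(m : 𝓞 M)}} := (Ideal.finite_factors hspan).to_subtype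
    refine Finite.of_injective
      (β := {v : IsDedekindDomain.HeightOneSpectrum (𝓞 M) // v.asIdeal ∣ Ideal.span {(m : 𝓞 M)}})
      (fun P => ⟨⟨P.1, P.2.1.isPrime, ?_⟩, Ideal.dvd_span_singleton.2 P.2.2⟩) fun P Q h => ?_
    · intro h
      have := P.2.2
      rw [h, Ideal.mem_bot] at this
      exact hm this
    · exact Subtype.ext (by simpa using h)
  have hchoice : ∀ P : S, ∃ a : 𝓞 M, a ^ 2 - 4 ∉ P.1 ∧ (γ - a) ^ 2 - 4 ∉ P.1 := by
    rintro ⟨P, hP, -⟩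
    let _ := Ideal.Quotient.field P
    have he' : (Ideal.Quotient.mk P e) ^ 3 - Ideal.Quotient.mk P e = 1 := by
      rw [← map_pow, ← map_sub, he, map_one]
    obtain ⟨a, ha1, ha2⟩ := exists_sq_ne_four_and_sub_sq_ne_four he' (Ideal.Quotient.mk P γ)
    obtain ⟨a, rfl⟩ := Ideal.Quotient.mk_surjective a
    refine ⟨a, fun h => ha1 ?_, fun h => ha2 ?_⟩
    · simpa [map_ofNat] using Ideal.Quotient.eq_zero_iff_mem.2 h
    · simpa [map_ofNat] using Ideal.Quotient.eq_zero_iff_mem.2 h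
  choose a ha1 ha2 using hchoice
  obtain ⟨α, hα⟩ := Ideal.exists_forall_sub_mem_ideal (I := fun P : S => P.1) (by
    intro P Q hPQ
    have := P.2.1
    have := Q.2.1
    exact Ideal.isCoprime_iff_sup_eq.2
      (Ideal.IsMaximal.coprime_of_ne ‹_› ‹_› fun h => hPQ (Subtype.ext h))) a
  have hcop : ∀ z : 𝓞 M, (∀ P : S, z ∉ P.1) → IsCoprime z (m : 𝓞 M) := by
    intro z hz
    by_contra hcon
    rw [← Ideal.isCoprime_span_singleton_iff, Ideal.isCoprime_iff_sup_eq] at hcon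
    obtain ⟨P, hP, hle⟩ := Ideal.exists_le_maximal _ hcon
    refine hz ⟨P, hP, hle (Ideal.mem_sup_right (Ideal.mem_span_singleton_self _))⟩ ?_
    exact hle (Ideal.mem_sup_left (Ideal.mem_span_singleton_self _))
  refine ⟨α, hcop _ fun P h => ha1 P ?_, hcop _ fun P h => ha2 P ?_⟩
  · have : a P ^ 2 - 4 = α ^ 2 - 4 - (α + a P) * (α - a P) := by ring
    rw [this]
    exact sub_mem h (P.1.mul_mem_left _ (hα P))
  · have : (γ - a P) ^ 2 - 4 = (γ - α) ^ 2 - 4 + (2 * γ - α - a P) * (α - a P) := by ring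
    rw [this]
    exact add_mem h (P.1.mul_mem_left _ (hα P))

theorem isIntegral_of_sq_mul {D : 𝓞 M} (hD : ∀ P : Ideal (𝓞 M), P.IsPrime → P ≠ ⊥ → D ∉ P ^ 2)
    {b : M} (hb : IsIntegral ℤ (b ^ 2 * D)) : IsIntegral ℤ b := by
  obtain ⟨c, hc⟩ : ∃ c : 𝓞 M, (c : M) = b ^ 2 * D := ⟨⟨_, hb⟩, rfl⟩
  obtain ⟨b', rfl⟩ := IsDedekindDomain.HeightOneSpectrum.mem_integers_of_valuation_le_one
    (R := 𝓞 M) M b fun v => by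
      by_contra! hlt
      refine hD v.asIdeal v.isPrime v.ne_bot ?_
      rw [← v.intValuation_le_pow_iff_mem, ← v.valuation_of_algebraMap (K := M)]
      have h1 : v.valuation M (b ^ 2 * D) ≤ 1 := by
        rw [← hc]
        exact v.valuation_le_one c
      rw [map_mul, map_pow] at h1
      have h2 : WithZero.exp (1 : ℤ) ≤ v.valuation M b := by
        by_contra! h
        exact hlt.not_ge ((WithZero.lt_mul_exp_iff_le one_ne_zero).1 (by rwa [one_mul]))
      have h3 : WithZero.exp (2 : ℤ) ≤ v.valuation M b ^ 2 := by
        have := pow_le_pow_left₀ (zero_le) h2 2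
        simpa [← WithZero.exp_nsmul] using this
      have h4 : WithZero.exp (2 : ℤ) * v.valuation M (D : M) ≤ 1 :=
        (mul_le_mul_left h3 _).trans h1
      have h5 : WithZero.exp (-(2 : ℤ)) * (WithZero.exp (2 : ℤ) * v.valuation M (D : M)) ≤
        WithZero.exp (-(2 : ℤ)) := by
          simpa using mul_le_mul_right h4 (WithZero.exp (-(2 : ℤ)))
      rw [← mul_assoc, ← WithZero.exp_add] at h5
      simpa using h5
  exact b'.isIntegral_coe

open Polynomial in
theorem isIntegral_of_sq_sub_mul_add_one {Ω : Type*} [Field Ω] {a w : Ω} (ha : IsIntegral ℤ a)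
    (hw : w ^ 2 - a * w + 1 = 0) : IsIntegral ℤ w := by
  refine isIntegral_trans (A := integralClosure ℤ Ω) w
    ⟨C 1 * X ^ 2 + C (-⟨a, ha⟩) * X + C 1, leadingCoeff_quadratic one_ne_zero, ?_⟩
  rw [← hw]
  simp
  ring

open Polynomial in
theorem exists_eq_add_mul_of_isIntegral {Ω : Type*} [Field Ω] [Algebra M Ω] {α : 𝓞 M}
    (hα : ∀ P : Ideal (𝓞 M), P.IsPrime → P ≠ ⊥ → α ^ 2 - 4 ∉ P ^ 2) {w : Ω}
    (hw : w ^ 2 - algebraMap M Ω α * w + 1 = 0) {x : Ω} (hx : x ∈ IntermediateField.adjoin M {w})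
    (hxint : IsIntegral ℤ x) :
    ∃ a b : 𝓞 M, x = algebraMap M Ω a + algebraMap M Ω b * w := by
  have hwint : IsIntegral ℤ w :=
    isIntegral_of_sq_sub_mul_add_one (RingOfIntegers.isIntegral_coe α).algebraMap hw
  by_cases hxM : x ∈ (algebraMap M Ω).range
  · obtain ⟨y, rfl⟩ := hxM
    obtain ⟨a, rfl⟩ : ∃ a : 𝓞 M, (a : M) = y :=
      ⟨⟨y, (isIntegral_algebraMap_iff (algebraMap M Ω).injective).1 hxint⟩, rfl⟩
    exact ⟨a, 0, by simp⟩
  obtain ⟨a, b, rfl⟩ : ∃ a b : M, x = algebraMap M Ω a + algebraMap M Ω b * w := by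
    set f : M[X] := C 1 * X ^ 2 + C (-(α : M)) * X + C 1 with hf
    have hfm : f.Monic := leadingCoeff_quadratic one_ne_zero
    have hfw : aeval w f = 0 := by
      rw [← hw, hf]
      simp
      ring
    have halg : IsAlgebraic M w := ⟨f, hfm.ne_zero, hfw⟩
    rw [← IntermediateField.mem_toSubalgebra,
      IntermediateField.adjoin_simple_toSubalgebra_of_isAlgebraic halg,
      Algebra.adjoin_singleton_eq_range_aeval] at hx
    obtain ⟨p, rfl⟩ := hx
    have hdeg : (p %ₘ f).natDegree ≤ 1 := by
      have h1 := degree_modByMonic_lt p hfm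
      rw [hf, degree_quadratic one_ne_zero, ← hf] at h1
      exact natDegree_le_of_degree_le (Order.le_of_lt_succ h1)
    obtain ⟨b, a, hab⟩ := exists_eq_X_add_C_of_natDegree_le_one hdeg
    refine ⟨a, b, ?_⟩
    change aeval w p = _
    rw [← aeval_modByMonic_eq_self_of_root hfw, hab]
    simp [add_comm]
  have hb : IsIntegral ℤ b := by
    refine isIntegral_of_sq_mul hα ?_
    set x := algebraMap M Ω a + algebraMap M Ω b * w with hx'
    obtain ⟨t, ht⟩ : ∃ t, t = 2 * a + b * α := ⟨_, rfl⟩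
    obtain ⟨n, hn⟩ : ∃ n, n = a ^ 2 + a * b * α + b ^ 2 := ⟨_, rfl⟩
    set f : M[X] := C 1 * X ^ 2 + C (-t) * X + C n with hf
    have hfm : f.Monic := leadingCoeff_quadratic one_ne_zero
    have hfx : aeval x f = 0 := by
      rw [hf, hx', ht, hn]
      simp [map_ofNat]
      linear_combination (algebraMap M Ω b) ^ 2 * hw
    have hxO : IsIntegral (𝓞 M) x := hxint.tower_top
    have hmin : f = minpoly M x := by
      refine eq_of_monic_of_dvd_of_natDegree_le (minpoly.monic hxint.tower_top) hfm
        (minpoly.dvd M x hfx) ?_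
      rw [hf, natDegree_quadratic one_ne_zero]
      exact (minpoly.two_le_natDegree_iff hxint.tower_top).2 hxM
    rw [minpoly.isIntegrallyClosed_eq_field_fractions' M hxO] at hmin
    have h0 := congrArg (coeff · 0) hmin
    have h1 := congrArg (coeff · 1) hmin
    simp [hf, coeff_X, coeff_C] at h0 h1
    have : b ^ 2 * ((α ^ 2 - 4 : 𝓞 M) : M) =
        (((minpoly (𝓞 M) x).coeff 1 ^ 2 - 4 * (minpoly (𝓞 M) x).coeff 0 : 𝓞 M) : M) := by
      simp [← h0, ← h1, map_ofNat, ht, hn]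
      ring
    rw [this]
    exact RingOfIntegers.isIntegral_coe _
  have ha : IsIntegral ℤ a := by
    rw [← isIntegral_algebraMap_iff (algebraMap M Ω).injective]
    have h1 : IsIntegral ℤ (algebraMap M Ω b * w) := (hb.algebraMap).mul hwint
    simpa using hxint.sub h1
  exact ⟨⟨a, ha⟩, ⟨b, hb⟩, rfl⟩

end

namespace IntermediateField

section
variable {Ω : Type*} [Field Ω] [CharZero Ω]

/-- The algebraic integers of a subfield `M` of `Ω`, as a subring of `Ω`. -/
def integers (M : IntermediateField ℚ Ω) : Subring Ω :=
  M.toSubring ⊓ (integralClosure ℤ Ω).toSubring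

/-- The subring of `Ω` generated by the units of the algebraic integers of `M`. -/
def unitSpan (M : IntermediateField ℚ Ω) : Subring Ω :=
  Subring.closure {u | u ∈ M.integers ∧ u⁻¹ ∈ M.integers}

theorem mem_integers {M : IntermediateField ℚ Ω} {x : Ω} :
    x ∈ M.integers ↔ x ∈ M ∧ IsIntegral ℤ x := Iff.rfl

theorem mem_integers_iff_exists {M : IntermediateField ℚ Ω} {x : Ω} :
    x ∈ M.integers ↔ ∃ a : 𝓞 M, algebraMap M Ω a = x := by
  refine ⟨fun h => ⟨⟨⟨x, h.1⟩, ?_⟩, rfl⟩, ?_⟩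
  · exact (isIntegral_algebraMap_iff (algebraMap M Ω).injective).1 h.2
  · rintro ⟨a, rfl⟩
    exact ⟨(a : M).2, (RingOfIntegers.isIntegral_coe a).algebraMap⟩

theorem integers_mono {M N : IntermediateField ℚ Ω} (h : M ≤ N) : M.integers ≤ N.integers :=
  fun _ hx => ⟨h hx.1, hx.2⟩

theorem unitSpan_mono {M N : IntermediateField ℚ Ω} (h : M ≤ N) : M.unitSpan ≤ N.unitSpan :=
  Subring.closure_mono fun _ hu => ⟨integers_mono h hu.1, integers_mono h hu.2⟩

theorem mem_unitSpan_of_sq_sub_mul_add_one {M : IntermediateField ℚ Ω} {a w : Ω} (hwM : w ∈ M)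
    (ha : IsIntegral ℤ a) (h : w ^ 2 - a * w + 1 = 0) : w ∈ M.unitSpan ∧ a ∈ M.unitSpan := by
  have hinv : w⁻¹ = a - w := inv_eq_of_mul_eq_one_right (by linear_combination -h)
  have hw := isIntegral_of_sq_sub_mul_add_one ha h
  have h1 : w ∈ M.integers := ⟨hwM, hw⟩
  have h2 : w⁻¹ ∈ M.integers := ⟨M.inv_mem hwM, by rw [hinv]; exact ha.sub hw⟩
  have h3 : w ∈ M.unitSpan := Subring.subset_closure ⟨h1, h2⟩
  have h4 : w⁻¹ ∈ M.unitSpan := Subring.subset_closure ⟨h2, by rwa [inv_inv]⟩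
  refine ⟨h3, ?_⟩
  simpa [hinv] using add_mem h3 h4

open Polynomial in
theorem exists_sq_sub_mul_add_one [IsAlgClosed Ω] (a : Ω) : ∃ w : Ω, w ^ 2 - a * w + 1 = 0 := by
  obtain ⟨w, hw⟩ := IsAlgClosed.exists_root
    (C 1 * X ^ 2 + C (-a) * X + C 1 : Polynomial Ω)
    (by rw [degree_quadratic one_ne_zero]; decide)
  exact ⟨w, by simpa [IsRoot, sub_eq_add_neg] using hw⟩

theorem exists_finset_integers (M : IntermediateField ℚ Ω) [FiniteDimensional ℚ M] :
    ∃ s : Finset (𝓞 M), ∀ A : AddSubgroup Ω, (∀ a ∈ s, algebraMap M Ω a ∈ A) →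
      ∀ x ∈ M.integers, x ∈ A := by
  have : NumberField M := { }
  obtain ⟨s, hs⟩ := (Module.Finite.iff_addGroup_fg.1 (inferInstance : Module.Finite ℤ (𝓞 M))).out
  refine ⟨s, fun A hA x hx => ?_⟩
  obtain ⟨a, rfl⟩ := mem_integers_iff_exists.1 hx
  let f : 𝓞 M →+* Ω := (algebraMap M Ω).comp (algebraMap (𝓞 M) M)
  have h : AddSubgroup.closure (s : Set (𝓞 M)) ≤ A.comap f.toAddMonoidHom :=
    (AddSubgroup.closure_le _).2 hA
  rw [hs] at h
  exact h (AddSubgroup.mem_top a)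

theorem exists_ge_mem_unitSpan [IsAlgClosed Ω] {M : IntermediateField ℚ Ω} [FiniteDimensional ℚ M]
    {m : ℕ} (hm0 : 0 < m) (hm2 : 2 ∣ m) (hM : ∀ x ∈ M.integers, m * x ∈ M.unitSpan) {γ : Ω}
    (hγ : γ ∈ M.integers)
    (hcop : ∃ u ∈ M.integers, ∃ v ∈ M.integers, u * (γ ^ 2 - 4) + v * m = 1) :
    ∃ N : IntermediateField ℚ Ω, M ≤ N ∧ FiniteDimensional ℚ N ∧
      (∀ x ∈ N.integers, m * x ∈ N.unitSpan) ∧ N.integers ≤ M.integers ⊔ N.unitSpan ∧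
      γ ∈ N.unitSpan := by
  have : NumberField M := { }
  obtain ⟨u, hu, v, hv, huv⟩ := hcop
  obtain ⟨γ, rfl⟩ := mem_integers_iff_exists.1 hγ
  obtain ⟨u, rfl⟩ := mem_integers_iff_exists.1 hu
  obtain ⟨v, rfl⟩ := mem_integers_iff_exists.1 hv
  obtain ⟨β, hβ⟩ := exists_sq_sub_four_notMem_prime_sq hm0 hm2 (γ := γ) ⟨u, v, by
    apply RingOfIntegers.coe_injective
    apply (algebraMap M Ω).injective
    simp only [map_add, map_mul, map_sub, map_pow, map_ofNat, map_natCast, map_one]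
    exact huv⟩
  obtain ⟨w, hw⟩ := exists_sq_sub_mul_add_one (algebraMap M Ω (γ + m * β : 𝓞 M))
  have hαint : IsIntegral ℤ (algebraMap M Ω (γ + m * β : 𝓞 M)) :=
    (RingOfIntegers.isIntegral_coe _).algebraMap
  have hwint : IsIntegral M w := (isIntegral_of_sq_sub_mul_add_one hαint hw).tower_top
  have hle : M ≤ (adjoin M {w}).restrictScalars ℚ := fun x hx =>
    (adjoin M {w}).algebraMap_mem (⟨x, hx⟩ : M)
  have hwN : w ∈ (adjoin M {w}).restrictScalars ℚ := mem_adjoin_simple_self M w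
  obtain ⟨hwu, hαu⟩ := mem_unitSpan_of_sq_sub_mul_add_one hwN hαint hw
  have hrep : ∀ x ∈ ((adjoin M {w}).restrictScalars ℚ).integers, ∃ a ∈ M.integers,
      ∃ b ∈ M.integers, x = a + b * w := fun x hx => by
    obtain ⟨a, b, h⟩ := exists_eq_add_mul_of_isIntegral hβ hw hx.1 hx.2
    exact ⟨_, mem_integers_iff_exists.2 ⟨a, rfl⟩, _, mem_integers_iff_exists.2 ⟨b, rfl⟩, h⟩
  refine ⟨(adjoin M {w}).restrictScalars ℚ, hle, ?_, fun x hx => ?_, fun x hx => ?_, ?_⟩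
  · have := adjoin.finiteDimensional hwint
    exact Module.Finite.trans (R := ℚ) M (adjoin M {w})
  · obtain ⟨a, ha, b, hb, rfl⟩ := hrep x hx
    rw [mul_add, ← mul_assoc]
    exact add_mem (unitSpan_mono hle (hM a ha)) (mul_mem (unitSpan_mono hle (hM b hb)) hwu)
  · obtain ⟨a, ha, b, hb, rfl⟩ := hrep x hx
    have h := le_sup_left (a := M.integers) (b := ((adjoin M {w}).restrictScalars ℚ).unitSpan)
    exact add_mem (h ha) (mul_mem (h hb) (le_sup_right (a := M.integers) hwu))
  · have h := sub_mem hαu (unitSpan_mono hle (hM _ (mem_integers_iff_exists.2 ⟨β, rfl⟩)))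
    simpa using h

theorem exists_ge_forall_mem_unitSpan [IsAlgClosed Ω] {M : IntermediateField ℚ Ω}
    [FiniteDimensional ℚ M] {m : ℕ} (hm0 : 0 < m) (hm2 : 2 ∣ m)
    (hM : ∀ x ∈ M.integers, m * x ∈ M.unitSpan) {s : Set Ω} (hs : s.Finite)
    (hsM : ∀ γ ∈ s, γ ∈ M.integers ∧
      ∃ u ∈ M.integers, ∃ v ∈ M.integers, u * (γ ^ 2 - 4) + v * m = 1) :
    ∃ N : IntermediateField ℚ Ω, M ≤ N ∧ FiniteDimensional ℚ N ∧
      (∀ x ∈ N.integers, m * x ∈ N.unitSpan) ∧ N.integers ≤ M.integers ⊔ N.unitSpan ∧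
      ∀ γ ∈ s, γ ∈ N.unitSpan := by
  induction s, hs using Set.Finite.induction_on with
  | empty => exact ⟨M, le_rfl, ‹_›, hM, le_sup_left, by simp⟩
  | @insert γ s _ _ ih =>
    obtain ⟨N, hMN, hfin, hN, hNM, hsN⟩ := ih fun γ hγ => hsM γ (Set.mem_insert_of_mem _ hγ)
    obtain ⟨hγ, u, hu, v, hv, huv⟩ := hsM γ (Set.mem_insert _ _)
    have hle := integers_mono hMN
    obtain ⟨N', hNN', hfin', hN', hNM', hγN'⟩ :=
      exists_ge_mem_unitSpan hm0 hm2 hN (hle hγ) ⟨u, hle hu, v, hle hv, huv⟩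
    refine ⟨N', hMN.trans hNN', hfin', hN', ?_, ?_⟩
    · refine hNM'.trans (sup_le (hNM.trans ?_) le_sup_right)
      exact sup_le_sup_left (unitSpan_mono hNN') _
    · rintro x (rfl | hx)
      · exact hγN'
      · exact unitSpan_mono hNN' (hsN x hx)

theorem exists_natCast_mul_mem_of_mem_adjoin {A : Subring Ω} {w x : Ω} (hw : w ∈ A)
    (hwint : IsIntegral ℚ w) (hx : x ∈ adjoin ℚ {w}) : ∃ k : ℕ, 0 < k ∧ k * x ∈ A := by
  rw [← mem_toSubalgebra, adjoin_simple_toSubalgebra_of_isAlgebraic hwint.isAlgebraic] at hx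
  induction hx using Algebra.adjoin_induction with
  | mem x hx => exact ⟨1, one_pos, by simpa [Set.mem_singleton_iff.1 hx] using hw⟩
  | algebraMap r =>
    refine ⟨r.den, r.den_pos, ?_⟩
    have h : (r.den : Ω) * algebraMap ℚ Ω r = r.num := by
      rw [eq_ratCast]
      exact_mod_cast congrArg (Rat.cast : ℚ → Ω) r.den_mul_eq_num
    rw [h]
    exact _root_.intCast_mem A _
  | add x y _ _ hx hy =>
    obtain ⟨k, hk, hkx⟩ := hx
    obtain ⟨l, hl, hly⟩ := hy
    refine ⟨k * l, Nat.mul_pos hk hl, ?_⟩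
    have h : ((k * l : ℕ) : Ω) * (x + y) = l * (k * x) + k * (l * y) := by
      push_cast
      ring
    rw [h]
    exact add_mem (mul_mem (_root_.natCast_mem A l) hkx) (mul_mem (_root_.natCast_mem A k) hly)
  | mul x y _ _ hx hy =>
    obtain ⟨k, hk, hkx⟩ := hx
    obtain ⟨l, hl, hly⟩ := hy
    refine ⟨k * l, Nat.mul_pos hk hl, ?_⟩
    have h : ((k * l : ℕ) : Ω) * (x * y) = (k * x) * (l * y) := by
      push_cast
      ring
    rw [h]
    exact mul_mem hkx hly

theorem exists_forall_natCast_mul_mem_unitSpan {M : IntermediateField ℚ Ω} [FiniteDimensional ℚ M]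
    (hM : ∀ x ∈ M, ∃ k : ℕ, 0 < k ∧ k * x ∈ M.unitSpan) :
    ∃ m : ℕ, 0 < m ∧ 2 ∣ m ∧ ∀ x ∈ M.integers, m * x ∈ M.unitSpan := by
  obtain ⟨s, hs⟩ := exists_finset_integers M
  choose k hk0 hk using fun a : 𝓞 M => hM (algebraMap M Ω a) (a : M).2
  refine ⟨2 * ∏ a ∈ s, k a, Nat.mul_pos two_pos (Finset.prod_pos fun a _ => hk0 a),
    dvd_mul_right _ _, ?_⟩
  refine hs (M.unitSpan.toAddSubgroup.comap
    (AddMonoidHom.mulLeft ((2 * ∏ a ∈ s, k a : ℕ) : Ω))) fun a ha => ?_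
  obtain ⟨l, hl⟩ := (Finset.dvd_prod_of_mem k ha).mul_left 2
  change ((2 * ∏ a ∈ s, k a : ℕ) : Ω) * algebraMap M Ω a ∈ M.unitSpan
  rw [hl, mul_comm (k a), Nat.cast_mul, mul_assoc]
  exact mul_mem (_root_.natCast_mem _ l) (hk a)

theorem exists_ge_forall_exists_natCast_mul_mem [IsAlgClosed Ω] (K : IntermediateField ℚ Ω)
    [FiniteDimensional ℚ K] :
    ∃ M : IntermediateField ℚ Ω, K ≤ M ∧ FiniteDimensional ℚ M ∧
      ∀ x ∈ M, ∃ k : ℕ, 0 < k ∧ k * x ∈ M.unitSpan := by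
  obtain ⟨α, hα⟩ := @Field.exists_primitive_element ℚ K _ _ K.algebra' _ _
  have hαK : adjoin ℚ {(α : Ω)} = K := by
    rw [← lift_adjoin_simple, hα, lift_top]
  have halg : IsAlgebraic ℤ (α : Ω) := (IsFractionRing.isAlgebraic_iff ℤ ℚ Ω).2
    ((Algebra.IsIntegral.isIntegral (R := ℚ) α).isAlgebraic.algebraMap)
  obtain ⟨n, hn0, hn⟩ := halg.exists_integral_multiple
  obtain ⟨w, hw⟩ := exists_sq_sub_mul_add_one ((n : Ω) * α)
  have hint : IsIntegral ℤ ((n : Ω) * α) := by simpa using hn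
  have hwM : w ∈ adjoin ℚ {w} := mem_adjoin_simple_self ℚ w
  obtain ⟨hwu, -⟩ := mem_unitSpan_of_sq_sub_mul_add_one hwM hint hw
  have hwint : IsIntegral ℚ w := (isIntegral_of_sq_sub_mul_add_one hint hw).tower_top
  refine ⟨adjoin ℚ {w}, ?_, adjoin.finiteDimensional hwint, fun x hx =>
    exists_natCast_mul_mem_of_mem_adjoin hwu hwint hx⟩
  rw [← hαK, adjoin_simple_le_iff]
  have hn0' : (n : Ω) ≠ 0 := Int.cast_ne_zero.2 hn0
  have hw0 : w ≠ 0 := by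
    rintro rfl
    simp at hw
  have h : (α : Ω) = (n : Ω)⁻¹ * (w + w⁻¹) := by
    field_simp
    linear_combination -hw
  rw [h]
  exact mul_mem (inv_mem (intCast_mem _ n)) (add_mem hwM (inv_mem hwM))

open Polynomial in
theorem exists_ge_integers_le_unitSpan [IsAlgClosed Ω] (K : IntermediateField ℚ Ω)
    [FiniteDimensional ℚ K] :
    ∃ L : IntermediateField ℚ Ω, K ≤ L ∧ FiniteDimensional ℚ L ∧ L.integers ≤ L.unitSpan := by
  obtain ⟨e, he⟩ : ∃ e : Ω, e ^ 3 - e = 1 := by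
    obtain ⟨e, he⟩ := IsAlgClosed.exists_root
      (C 1 * X ^ 3 + C 0 * X ^ 2 + C (-1) * X + C (-1) : Polynomial Ω)
      (by rw [degree_cubic one_ne_zero]; decide)
    refine ⟨e, ?_⟩
    have : e ^ 3 + -e + -1 = 0 := by simpa [IsRoot] using he
    linear_combination this
  have heint : IsIntegral ℤ e :=
    ⟨C 1 * X ^ 3 + C 0 * X ^ 2 + C (-1) * X + C (-1),
      leadingCoeff_cubic one_ne_zero, by simp; linear_combination he⟩
  have := adjoin.finiteDimensional (K := ℚ) heint.tower_top
  obtain ⟨M, hKM, hfin, hM⟩ := exists_ge_forall_exists_natCast_mul_mem (K ⊔ adjoin ℚ {e})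
  obtain ⟨m, hm0, hm2, hm⟩ := exists_forall_natCast_mul_mem_unitSpan hM
  have : NumberField M := { }
  have heM : e ∈ M := hKM (le_sup_right (a := K) (mem_adjoin_simple_self ℚ e))
  obtain ⟨e, rfl⟩ := mem_integers_iff_exists.1 ⟨heM, heint⟩
  have he' : e ^ 3 - e = 1 := by
    apply RingOfIntegers.coe_injective
    apply (algebraMap M Ω).injective
    simpa using he
  obtain ⟨s, hs⟩ := exists_finset_integers M
  choose α hα1 hα2 using exists_isCoprime_sq_sub_four he' hm0
  let f : 𝓞 M →+* Ω := (algebraMap M Ω).comp (algebraMap (𝓞 M) M)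
  have hf : ∀ a, f a ∈ M.integers := fun a => mem_integers_iff_exists.2 ⟨a, rfl⟩
  have hcop : ∀ a : 𝓞 M, IsCoprime (a ^ 2 - 4) (m : 𝓞 M) → f a ∈ M.integers ∧
      ∃ u ∈ M.integers, ∃ v ∈ M.integers, u * (f a ^ 2 - 4) + v * m = 1 := by
    rintro a ⟨u, v, huv⟩
    exact ⟨hf a, f u, hf u, f v, hf v, by simpa [map_ofNat] using congrArg f huv⟩
  obtain ⟨L, hML, hfinL, -, hLM, hL⟩ := exists_ge_forall_mem_unitSpan hm0 hm2 hm
    ((s.finite_toSet.image fun a => f (α a)).union (s.finite_toSet.image fun a => f (a - α a)))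
    (by
      rintro _ (⟨a, -, rfl⟩ | ⟨a, -, rfl⟩)
      · exact hcop _ (hα1 a)
      · exact hcop _ (hα2 a))
  refine ⟨L, (le_sup_left.trans hKM).trans hML, hfinL, hLM.trans (sup_le ?_ le_rfl)⟩
  refine hs L.unitSpan.toAddSubgroup fun a ha => ?_
  have h1 := hL _ (Or.inl ⟨a, ha, rfl⟩)
  have h2 := hL _ (Or.inr ⟨a, ha, rfl⟩)
  have h := add_mem h1 h2
  simp only [← map_add, add_sub_cancel] at h
  exact h

theorem addSubgroup_closure_isUnit_eq_top {L : IntermediateField ℚ Ω}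
    (hL : L.integers ≤ L.unitSpan) : AddSubgroup.closure {x : 𝓞 L | IsUnit x} = ⊤ := by
  let f : 𝓞 L →+* Ω := (algebraMap L Ω).comp (algebraMap (𝓞 L) L)
  have hf : Function.Injective f :=
    (algebraMap L Ω).injective.comp RingOfIntegers.coe_injective
  have hle : L.unitSpan ≤ (Subring.closure (IsUnit.submonoid (𝓞 L) : Set (𝓞 L))).map f := by
    refine Subring.closure_le.2 ?_
    rintro u ⟨hu, hu'⟩
    rcases eq_or_ne u 0 with rfl | hu0
    · exact zero_mem _
    obtain ⟨a, rfl⟩ := mem_integers_iff_exists.1 hu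
    obtain ⟨b, hb⟩ := mem_integers_iff_exists.1 hu'
    refine ⟨a, Subring.subset_closure ?_, rfl⟩
    refine IsUnit.of_mul_eq_one b (hf ?_)
    change f a ≠ 0 at hu0
    change f b = (f a)⁻¹ at hb
    rw [map_mul, hb, mul_inv_cancel₀ hu0, map_one]
  refine eq_top_iff.2 fun x _ => ?_
  obtain ⟨y, hy, hyx⟩ := hle (hL (mem_integers_iff_exists.2 ⟨x, rfl⟩))
  obtain rfl : y = x := hf hyx
  change y ∈ Subring.closure (IsUnit.submonoid (𝓞 L) : Set (𝓞 L)) at hy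
  rwa [Subring.mem_closure_iff, Submonoid.closure_eq] at hy

end

end IntermediateField

/-- Frei (2012): for every number field `K` there is a number field `L`
containing `K` (i.e. admitting an embedding of `K`, automatically a
`ℚ`-algebra embedding) whose ring of integers is generated by its units. -/
theorem frei_generated_by_units (K : Type) [Field K] [NumberField K] :
    ∃ (L : Type) (fL : Field L), @NumberField L fL ∧
      Nonempty (K →+* L) ∧ @RingOfIntegersGeneratedByUnits L fL := by
  let φ : K →+* ℂ := Classical.arbitrary _
  have : FiniteDimensional ℚ φ.toRatAlgHom.fieldRange :=
    LinearMap.finiteDimensional_range φ.toRatAlgHom.toLinearMap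
  obtain ⟨L, hKL, hfin, hL⟩ :=
    IntermediateField.exists_ge_integers_le_unitSpan φ.toRatAlgHom.fieldRange
  refine ⟨L, inferInstance, { }, ⟨φ.codRestrict L.toSubring fun x => hKL ⟨x, rfl⟩⟩,
    IntermediateField.addSubgroup_closure_isUnit_eq_top hL⟩
end
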